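/- arXiv:2601.14151 — 2 statements merged into one kernel-verified Lean document; each statement's English description precedes it below -/
import Mathlib

section
/- Let c > 0 be a real number and let f : ℕ → ℕ be strictly increasing with lim_{n→∞} f(n)/n^{3/2} = c. Then the set of achievable burning densities is P(G(f)) = [0, (1+√6·c)^{-2}]. -/
open Filter Asymptotics

/-- Membership in the grid `[-f n, f n]^2 ⊆ ℤ × ℤ`. -/
def inGrid (f : ℕ → ℕ) (n : ℕ) (p : ℤ × ℤ) : Prop :=
  |p.1| ≤ (f n : ℤ) ∧ |p.2| ≤ (f n : ℤ)

instance (f : ℕ → ℕ) (n : ℕ) : DecidablePred (inGrid f n) := fun _ => by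
  unfold inGrid; infer_instance

/-- The four lattice neighbours (at `L¹`-distance one) of a point. -/
def nbrs (p : ℤ × ℤ) : Finset (ℤ × ℤ) :=
  {(p.1 + 1, p.2), (p.1 - 1, p.2), (p.1, p.2 + 1), (p.1, p.2 - 1)}

/-- An activator sequence: whenever `V n ≠ ∅` (for `n ≥ 1`), the activated vertex
lies in the grid at time `n`. -/
def IsActivator (f : ℕ → ℕ) (V : ℕ → Option (ℤ × ℤ)) : Prop :=
  ∀ n, 1 ≤ n → ∀ p, V n = some p → inGrid f n p

/-- The burning process: `B 0 = ∅`, and `B n` is obtained from `B (n-1)` by adding all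
vertices of the grid at time `n` adjacent to a vertex of `B (n-1)`, and then adding
the activator `V n` if it is not `∅`. -/
def burnSet (f : ℕ → ℕ) (V : ℕ → Option (ℤ × ℤ)) : ℕ → Finset (ℤ × ℤ)
  | 0 => ∅
  | n + 1 =>
    let B := burnSet f V n
    let spread := B ∪ (B.biUnion nbrs).filter (inGrid f (n + 1))
    match V (n + 1) with
    | none => spread
    | some v => insert v spread

/-- The proportion `|B n| / |V(G n)|` of burning vertices at time `n`. -/
noncomputable def densitySeq (f : ℕ → ℕ) (V : ℕ → Option (ℤ × ℤ)) (n : ℕ) : ℝ :=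
  ((burnSet f V n).card : ℝ) / (2 * (f n : ℝ) + 1) ^ 2

/-- The lower burning density `δ̲(G(f), V)`. -/
noncomputable def lowerDensity (f : ℕ → ℕ) (V : ℕ → Option (ℤ × ℤ)) : ℝ :=
  liminf (densitySeq f V) atTop

/-- The upper burning density `δ̄(G(f), V)`. -/
noncomputable def upperDensity (f : ℕ → ℕ) (V : ℕ → Option (ℤ × ℤ)) : ℝ :=
  limsup (densitySeq f V) atTop

/-- The burning density of `V` in `G(f)` exists and equals `ρ`. -/
def HasBurningDensity (f : ℕ → ℕ) (V : ℕ → Option (ℤ × ℤ)) (ρ : ℝ) : Prop :=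
  Tendsto (densitySeq f V) atTop (nhds ρ)

/-- `P(G(f))`: the set of `ρ ∈ [0,1]` achievable as the burning density of some
non-empty activator sequence. -/
def densSet (f : ℕ → ℕ) : Set ℝ :=
  {ρ | ρ ∈ Set.Icc (0 : ℝ) 1 ∧
    ∃ V : ℕ → Option (ℤ × ℤ), IsActivator f V ∧ (∃ t, 1 ≤ t ∧ V t ≠ none) ∧
      HasBurningDensity f V ρ}

/-- The controlled growth requirement. -/
def ControlledGrowth (f : ℕ → ℕ) : Prop :=
  (∀ᶠ n in atTop, f n < f (n + 1)) ∧
  (∀ ε : ℕ → ℕ, (fun n => (ε n : ℝ)) =o[atTop] (fun n => (n : ℝ)) →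
    Tendsto (fun n => (f (n + ε n) : ℝ) / (f n : ℝ)) atTop (nhds 1)) ∧
  (∀ c : ℝ, 0 < c → ∃ d : ℝ, 0 < d ∧
    ∀ᶠ n in atTop, (1 + d) * (f n : ℝ) ≤ (f (n + ⌈c * n⌉₊) : ℝ))

/-- The `L¹`-ball of radius `k` around `v`. -/
noncomputable def l1Ball (v : ℤ × ℤ) (k : ℕ) : Finset (ℤ × ℤ) :=
  (Finset.Icc (v.1 - k) (v.1 + k) ×ˢ Finset.Icc (v.2 - k) (v.2 + k)).filter
    fun p => |p.1 - v.1| + |p.2 - v.2| ≤ k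

lemma mem_l1Ball {v p : ℤ × ℤ} {k : ℕ} :
    p ∈ l1Ball v k ↔ |p.1 - v.1| + |p.2 - v.2| ≤ k := by
  simp only [l1Ball, Finset.mem_filter, Finset.mem_product, Finset.mem_Icc, and_iff_right_iff_imp,
    Int.abs_eq_natAbs]
  omega

/-- An `L¹`-ball is the disjoint union of two rotated square grids. -/
lemma card_l1Ball (v : ℤ × ℤ) (k : ℕ) : (l1Ball v k).card = (k + 1) ^ 2 + k ^ 2 := by
  let φ : ℕ → ℕ × ℕ → ℤ × ℤ := fun m q => (v.1 - m + q.1 + q.2, v.2 + q.1 - q.2)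
  have hφ : ∀ m, Function.Injective (φ m) := by
    rintro m ⟨a, b⟩ ⟨a', b'⟩ h
    simp only [φ, Prod.mk.injEq] at h ⊢
    omega
  have hsplit : l1Ball v k =
      (Finset.range (k + 1) ×ˢ Finset.range (k + 1)).image (φ k) ∪
        (Finset.range k ×ˢ Finset.range k).image (φ (k - 1)) := by
    ext ⟨x, y⟩
    simp only [mem_l1Ball, Int.abs_eq_natAbs, Finset.mem_union, Finset.mem_image,
      Finset.mem_product, Finset.mem_range, Prod.exists, φ, Prod.mk.injEq]
    constructor
    · intro h
      rcases Int.emod_two_eq_zero_or_one (x - v.1 + (y - v.2) + k) with hp | hp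
      · left
        refine ⟨((x - v.1 + (y - v.2) + k) / 2).toNat,
          ((x - v.1 - (y - v.2) + k) / 2).toNat, ?_, ?_, ?_⟩ <;> omega
      · right
        refine ⟨((x - v.1 + (y - v.2) + k - 1) / 2).toNat,
          ((x - v.1 - (y - v.2) + k - 1) / 2).toNat, ?_, ?_, ?_⟩ <;> omega
    · rintro (⟨a, b, h, h'⟩ | ⟨a, b, h, h'⟩) <;> omega
  rw [hsplit, Finset.card_union_of_disjoint, Finset.card_image_of_injective _ (hφ _),
    Finset.card_image_of_injective _ (hφ _)]
  · simp [sq]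
  · rw [Finset.disjoint_left]
    intro p h h'
    simp only [Finset.mem_image, Finset.mem_product, Finset.mem_range, Prod.exists, φ] at h h'
    obtain ⟨a, b, h, rfl⟩ := h
    obtain ⟨a', b', h', he⟩ := h'
    simp only [Prod.mk.injEq] at he
    omega

/-- Since the grids grow by at least one in each step, fires spread unhindered. -/
lemma mem_burnSet_iff {f : ℕ → ℕ} (hf : StrictMono f) {V : ℕ → Option (ℤ × ℤ)}
    (hV : IsActivator f V) (n : ℕ) (p : ℤ × ℤ) :
    p ∈ burnSet f V n ↔ ∃ t v, 1 ≤ t ∧ t ≤ n ∧ V t = some v ∧ p ∈ l1Ball v (n - t) := by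
  induction n generalizing p with
  | zero =>
    simp only [burnSet, Finset.notMem_empty, false_iff]
    rintro ⟨t, v, h, h', -⟩
    omega
  | succ n ih =>
    have key : p ∈ burnSet f V (n + 1) ↔
        (p ∈ burnSet f V n ∨ ((∃ q ∈ burnSet f V n, p ∈ nbrs q) ∧ inGrid f (n + 1) p)) ∨
          V (n + 1) = some p := by
      rw [burnSet]
      cases V (n + 1) <;> simp [eq_comm, or_comm]
    rw [key]
    constructor
    · rintro ((h | ⟨⟨q, hq, hp⟩, -⟩) | h)
      · obtain ⟨t, v, h1, h2, h3, h4⟩ := (ih p).1 h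
        refine ⟨t, v, h1, by omega, h3, ?_⟩
        rw [mem_l1Ball] at h4 ⊢
        omega
      · obtain ⟨t, v, h1, h2, h3, h4⟩ := (ih q).1 hq
        refine ⟨t, v, h1, by omega, h3, ?_⟩
        rw [mem_l1Ball, Int.abs_eq_natAbs, Int.abs_eq_natAbs] at h4 ⊢
        obtain ⟨x, y⟩ := p
        simp only [nbrs, Finset.mem_insert, Finset.mem_singleton, Prod.mk.injEq] at hp
        omega
      · exact ⟨n + 1, p, by omega, le_rfl, h, by simp [mem_l1Ball]⟩
    · rintro ⟨t, v, h1, h2, h3, h4⟩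
      rcases h2.eq_or_lt with rfl | h2
      · right
        rw [mem_l1Ball, Int.abs_eq_natAbs, Int.abs_eq_natAbs] at h4
        rw [h3, Option.some_inj]
        ext <;> omega
      left
      have hgrid : inGrid f (n + 1) p := by
        have hg := hV t h1 v h3
        have hle : f t + (n + 1 - t) ≤ f (n + 1) := by
          have := hf.add_le_nat (n + 1 - t) t
          rw [show n + 1 - t + t = n + 1 by omega] at this
          omega
        rw [mem_l1Ball] at h4
        simp only [inGrid, Int.abs_eq_natAbs] at hg h4 ⊢
        omega
      by_cases hd : |p.1 - v.1| + |p.2 - v.2| ≤ ((n - t : ℕ) : ℤ)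
      · exact Or.inl ((ih p).2 ⟨t, v, h1, by omega, h3, mem_l1Ball.2 hd⟩)
      right
      refine ⟨?_, hgrid⟩
      have close : ∀ q : ℤ × ℤ, |q.1 - v.1| + |q.2 - v.2| ≤ ((n - t : ℕ) : ℤ) → p ∈ nbrs q →
          ∃ q ∈ burnSet f V n, p ∈ nbrs q := fun q hq hp =>
        ⟨q, (ih q).2 ⟨t, v, h1, by omega, h3, mem_l1Ball.2 hq⟩, hp⟩
      obtain ⟨x, y⟩ := p
      simp only [mem_l1Ball, Int.abs_eq_natAbs] at h4 hd close
      rcases lt_trichotomy x v.1 with hx | hx | hx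
      · exact close (x + 1, y) (by simp only; omega) (by simp [nbrs])
      · rcases lt_trichotomy y v.2 with hy | hy | hy
        · exact close (x, y + 1) (by simp only; omega) (by simp [nbrs])
        · omega
        · exact close (x, y - 1) (by simp only; omega) (by simp [nbrs])
      · exact close (x - 1, y) (by simp only; omega) (by simp [nbrs])

lemma card_burnSet_le_of_bound {f : ℕ → ℕ} (hf : StrictMono f) {g : ℕ → ℕ} (hg : Monotone g)
    {V : ℕ → Option (ℤ × ℤ)} (hV : IsActivator f V) (hVg : IsActivator g V) {m n : ℕ} (h : m ≤ n) :
    (burnSet f V n).card ≤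
      (2 * (g m + n) + 1) ^ 2 + ∑ k ∈ Finset.range (n - m), ((k + 1) ^ 2 + k ^ 2) := by
  let I : Finset ℤ := Finset.Icc (-(g m + n : ℕ)) (g m + n : ℕ)
  have hI : I.card = 2 * (g m + n) + 1 := by
    simp only [I, Int.card_Icc]
    omega
  have hsub : burnSet f V n ⊆ (I ×ˢ I) ∪
      (Finset.range (n - m)).biUnion fun k => l1Ball ((V (n - k)).getD 0) k := by
    intro p hp
    obtain ⟨t, v, h1, h2, h3, h4⟩ := (mem_burnSet_iff hf hV n p).1 hp
    rw [Finset.mem_union]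
    rcases le_or_gt t m with htm | htm
    · left
      have hv := hVg t h1 v h3
      have := hg htm
      rw [mem_l1Ball] at h4
      simp only [inGrid, Int.abs_eq_natAbs] at hv h4
      simp only [I, Finset.mem_product, Finset.mem_Icc]
      omega
    · right
      refine Finset.mem_biUnion.2 ⟨n - t, Finset.mem_range.2 (by omega), ?_⟩
      rwa [Nat.sub_sub_self h2, h3]
  calc (burnSet f V n).card ≤ _ := Finset.card_le_card hsub
    _ ≤ _ := Finset.card_union_le _ _
    _ ≤ _ := by
      gcongr
      · rw [Finset.card_product, hI, sq]
      · exact Finset.card_biUnion_le.trans (Finset.sum_le_sum fun k _ => (card_l1Ball _ k).le)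

lemma sum_range_sq_add_sq (N : ℕ) :
    ∑ k ∈ Finset.range N, (((k : ℝ) + 1) ^ 2 + (k : ℝ) ^ 2) =
      (N : ℝ) * (2 * (N : ℝ) ^ 2 + 1) / 3 := by
  induction N with
  | zero => simp
  | succ N ih => rw [Finset.sum_range_succ, ih]; push_cast; ring

/-- The share of time at which the boundary of the saturated region was activated. -/
lemma optimal_split (γ : ℝ) (hγ : 0 < γ) :
    4 * γ ^ 2 * ((1 + √6 * γ)⁻¹) ^ 3 + 2 / 3 * (1 - (1 + √6 * γ)⁻¹) ^ 3 =
      (2 * γ / (1 + √6 * γ)) ^ 2 := by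
  have h6 : √6 ^ 2 = 6 := Real.sq_sqrt (by norm_num)
  have hpos : 0 < 1 + √6 * γ := by positivity
  have : 1 - (1 + √6 * γ)⁻¹ = √6 * γ * (1 + √6 * γ)⁻¹ := by field_simp; ring
  rw [this, div_eq_mul_inv]
  set y := (1 + √6 * γ)⁻¹
  have hy : √6 * γ * y = 1 - y := this.symm
  calc _ = 4 * γ ^ 2 * y ^ 3 + 2 / 3 * √6 ^ 2 * γ ^ 2 * y ^ 2 * (√6 * γ * y) := by ring
    _ = _ := by rw [hy, h6]; ring

lemma tendsto_floor_mul_div (x : ℝ) (hx : 0 ≤ x) :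
    Tendsto (fun n : ℕ => (⌊x * n⌋₊ : ℝ) / n) atTop (nhds x) :=
  (tendsto_nat_floor_mul_div_atTop hx).comp tendsto_natCast_atTop_atTop

lemma tendsto_floor_mul (x : ℝ) (hx : 0 < x) :
    Tendsto (fun n : ℕ => ⌊x * n⌋₊) atTop atTop :=
  tendsto_nat_floor_atTop.comp (tendsto_natCast_atTop_atTop.const_mul_atTop hx)

lemma rpow_three_halves_sq (n : ℕ) : ((n : ℝ) ^ ((3 : ℝ) / 2)) ^ 2 = (n : ℝ) ^ 3 := by
  rw [← Real.rpow_natCast, ← Real.rpow_mul (by positivity)]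
  norm_num

lemma tendsto_one_div_rpow_three_halves :
    Tendsto (fun n : ℕ => (1 : ℝ) / (n : ℝ) ^ ((3 : ℝ) / 2)) atTop (nhds 0) := by
  simp only [one_div]
  exact ((tendsto_rpow_atTop (by norm_num)).comp tendsto_natCast_atTop_atTop).inv_tendsto_atTop

lemma tendsto_div_rpow_three_halves :
    Tendsto (fun n : ℕ => (n : ℝ) / (n : ℝ) ^ ((3 : ℝ) / 2)) atTop (nhds 0) := by
  have h := (tendsto_rpow_neg_atTop (show (0 : ℝ) < 1 / 2 by norm_num)).comp
    (tendsto_natCast_atTop_atTop (R := ℝ))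
  refine h.congr' ?_
  filter_upwards [eventually_gt_atTop 0] with n hn
  have hn' : (0 : ℝ) < n := by exact_mod_cast hn
  simp only [Function.comp]
  rw [eq_div_iff (by positivity), ← Real.rpow_add hn']
  norm_num

lemma card_burnSet_upper {f : ℕ → ℕ} (hf : StrictMono f) {g : ℕ → ℕ} (hg : Monotone g)
    {V : ℕ → Option (ℤ × ℤ)} (hV : IsActivator f V) (hVg : IsActivator g V) {γ : ℝ} (hγ : 0 < γ)
    (hlim : Tendsto (fun n => (g n : ℝ) / (n : ℝ) ^ ((3 : ℝ) / 2)) atTop (nhds γ)) :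
    ∃ U : ℕ → ℝ, Tendsto U atTop (nhds ((2 * γ / (1 + √6 * γ)) ^ 2)) ∧
      ∀ n, ((burnSet f V n).card : ℝ) / (n : ℝ) ^ 3 ≤ U n := by
  set x := (1 + √6 * γ)⁻¹ with hx
  have hx0 : 0 < x := by positivity
  have hx1 : x ≤ 1 := inv_le_one_of_one_le₀ (by simp; positivity)
  let m : ℕ → ℕ := fun n => ⌊x * n⌋₊
  have hmn : ∀ n, m n ≤ n := fun n => by
    refine Nat.floor_le_of_le ?_
    have : (0 : ℝ) ≤ n := by positivity
    nlinarith
  have hm : Tendsto (fun n => (m n : ℝ) / n) atTop (nhds x) := tendsto_floor_mul_div x hx0.le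
  refine ⟨fun n => ((2 * (g (m n) + n) + 1 : ℝ) ^ 2 +
    ((n - m n : ℕ) : ℝ) * (2 * ((n - m n : ℕ) : ℝ) ^ 2 + 1) / 3) / (n : ℝ) ^ 3, ?_, ?_⟩
  · rw [← optimal_split γ hγ, ← hx]
    have hgm : Tendsto (fun n => (g (m n) : ℝ) / (n : ℝ) ^ ((3 : ℝ) / 2)) atTop
        (nhds (γ * x ^ ((3 : ℝ) / 2))) := by
      have h1 := (hlim.comp (tendsto_floor_mul x hx0)).mul
        (hm.rpow_const (p := 3 / 2) (Or.inl hx0.ne'))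
      refine h1.congr' ?_
      filter_upwards [(tendsto_floor_mul x hx0).eventually_gt_atTop 0] with n hn
      have : (0 : ℝ) < m n := by exact_mod_cast hn
      simp only [Function.comp]
      rw [Real.div_rpow (by positivity) (by positivity)]
      change (g (m n) : ℝ) / (m n : ℝ) ^ (3 / 2 : ℝ) * _ = _
      field_simp
    have hinv1 : Tendsto (fun n : ℕ => (1 : ℝ) / (n : ℝ)) atTop (nhds 0) :=
      tendsto_one_div_atTop_nhds_zero_nat
    have hA := (((hgm.add tendsto_div_rpow_three_halves).const_mul 2).add
      tendsto_one_div_rpow_three_halves).pow 2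
    have hy : Tendsto (fun n => ((n - m n : ℕ) : ℝ) / n) atTop (nhds (1 - x)) := by
      refine (hm.const_sub 1).congr' ?_
      filter_upwards [eventually_gt_atTop 0] with n hn
      have : (n : ℝ) ≠ 0 := by positivity
      rw [Nat.cast_sub (hmn n)]
      field_simp
    have hB := (hy.mul (((hy.pow 2).const_mul 2).add (hinv1.pow 2))).div_const 3
    have hx3 : (x ^ ((3 : ℝ) / 2)) ^ 2 = x ^ 3 := by
      rw [← Real.rpow_natCast, ← Real.rpow_mul hx0.le]
      norm_num
    have hlimit : (2 * (γ * x ^ ((3 : ℝ) / 2) + 0) + 0) ^ 2 +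
        (1 - x) * (2 * (1 - x) ^ 2 + 0 ^ 2) / 3 = 4 * γ ^ 2 * x ^ 3 + 2 / 3 * (1 - x) ^ 3 := by
      rw [← hx3]; ring
    rw [← hlimit]
    refine (hA.add hB).congr' ?_
    filter_upwards [eventually_gt_atTop 0] with n hn
    have hn' : (0 : ℝ) < n := by exact_mod_cast hn
    rw [add_div]
    congr 1
    · rw [← rpow_three_halves_sq, ← div_pow]
      congr 1
      field_simp
    · field_simp
  · intro n
    have h := card_burnSet_le_of_bound hf hg hV hVg (hmn n)
    beta_reduce
    rw [← sum_range_sq_add_sq]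
    gcongr
    exact_mod_cast h

lemma cube_div_three_le_sum_sq (N : ℕ) :
    (N : ℝ) ^ 3 / 3 ≤ ∑ k ∈ Finset.range (N + 1), (k : ℝ) ^ 2 := by
  induction N with
  | zero => simp
  | succ N ih =>
    rw [Finset.sum_range_succ]
    push_cast
    have : (0 : ℝ) ≤ N := by positivity
    nlinarith

lemma sum_min_sq_lower {a : ℝ} (ha : 0 < a) {m n : ℕ} (h : m < n) (hm : (1 + a) * m ≤ n)
    (hm' : (n : ℝ) ≤ (1 + a) * (m + 1)) :
    a ^ 2 * ((m : ℝ) ^ 3 / 3) + (n - m - 1 : ℝ) ^ 3 / 3 ≤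
      ∑ t ∈ Finset.range (n + 1), (min ((n : ℝ) - t) (a * t)) ^ 2 := by
  obtain ⟨d, rfl⟩ := Nat.exists_eq_add_of_lt h
  rw [show m + d + 1 + 1 = (m + 1) + (d + 1) by ring, Finset.sum_range_add]
  refine add_le_add ?_ ?_
  · refine (mul_le_mul_of_nonneg_left (cube_div_three_le_sum_sq m) (sq_nonneg a)).trans_eq ?_
    rw [Finset.mul_sum]
    refine Finset.sum_congr rfl fun t ht => ?_
    have : (t : ℝ) ≤ m := by exact_mod_cast Nat.lt_succ_iff.1 (Finset.mem_range.1 ht)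
    rw [min_eq_right (by nlinarith), mul_pow]
  · have : ((m + d + 1 : ℕ) - m - 1 : ℝ) = d := by push_cast; ring
    rw [this]
    refine (cube_div_three_le_sum_sq d).trans_eq ?_
    rw [← Finset.sum_range_reflect]
    refine Finset.sum_congr rfl fun k hk => ?_
    have hk' := Finset.mem_range.1 hk
    have : ((d + 1 - 1 - k : ℕ) : ℝ) = d - k := by
      rw [Nat.cast_sub (by omega)]
      simp
    rw [this, min_eq_left]
    · push_cast; ring
    · push_cast at hm' ⊢
      have : (0 : ℝ) ≤ k := by positivity
      nlinarith

lemma card_burnSet_lower {f : ℕ → ℕ} (hf : StrictMono f)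
    {V : ℕ → Option (ℤ × ℤ)} (hV : IsActivator f V) {v : ℕ → ℤ × ℤ} {R : ℕ → ℕ} {t₀ : ℕ}
    (ht₀ : 1 ≤ t₀) (hVv : ∀ t ≥ t₀, V t = some (v t))
    (hdisj : ∀ s ≥ t₀, ∀ t ≥ t₀, s ≠ t → Disjoint (l1Ball (v s) (R s)) (l1Ball (v t) (R t)))
    (n : ℕ) :
    ∑ t ∈ Finset.Icc t₀ n, 2 * (min (n - t) (R t)) ^ 2 ≤ (burnSet f V n).card := by
  have hmono : ∀ (w : ℤ × ℤ) (k l : ℕ), k ≤ l → l1Ball w k ⊆ l1Ball w l := fun w k l h p hp => by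
    rw [mem_l1Ball] at hp ⊢
    omega
  have hsub : (Finset.Icc t₀ n).biUnion (fun t => l1Ball (v t) (min (n - t) (R t))) ⊆
      burnSet f V n := by
    intro p hp
    obtain ⟨t, ht, hp⟩ := Finset.mem_biUnion.1 hp
    rw [Finset.mem_Icc] at ht
    exact (mem_burnSet_iff hf hV n p).2 ⟨t, v t, by omega, ht.2, hVv t ht.1,
      hmono _ _ _ (min_le_left _ _) hp⟩
  refine le_trans ?_ (Finset.card_le_card hsub)
  rw [Finset.card_biUnion]
  · refine Finset.sum_le_sum fun t _ => ?_
    rw [card_l1Ball, two_mul]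
    gcongr
    exact Nat.le_succ _
  · intro s hs t ht hst
    rw [Finset.mem_coe, Finset.mem_Icc] at hs ht
    exact (hdisj s hs.1 t ht.1 hst).mono (hmono _ _ _ (min_le_right _ _))
      (hmono _ _ _ (min_le_right _ _))

lemma card_burnSet_lower_of_tendsto {f : ℕ → ℕ} (hf : StrictMono f)
    {V : ℕ → Option (ℤ × ℤ)} (hV : IsActivator f V) {v : ℕ → ℤ × ℤ} {R : ℕ → ℕ} {t₀ : ℕ}
    (ht₀ : 1 ≤ t₀) (hVv : ∀ t ≥ t₀, V t = some (v t))
    (hdisj : ∀ s ≥ t₀, ∀ t ≥ t₀, s ≠ t → Disjoint (l1Ball (v s) (R s)) (l1Ball (v t) (R t)))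
    {a : ℝ} (ha : 0 < a) (hR : Tendsto (fun t => (R t : ℝ) / t) atTop (nhds a)) {L : ℝ}
    (hL : L < 2 / 3 * (a ^ 2 * ((1 + a)⁻¹) ^ 3 + (1 - (1 + a)⁻¹) ^ 3)) :
    ∀ᶠ n in atTop, L < ((burnSet f V n).card : ℝ) / (n : ℝ) ^ 3 := by
  set x := (1 + a)⁻¹ with hx
  have hx0 : 0 < x := by positivity
  have hxa : (1 + a) * x = 1 := mul_inv_cancel₀ (by positivity)
  have hx1 : x < 1 := by nlinarith
  set S := 2 / 3 * (a ^ 2 * x ^ 3 + (1 - x) ^ 3) with hS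
  obtain ⟨η, hη, hη0, hη1⟩ : ∃ η : ℝ, L < η ^ 2 * S ∧ 0 < η ∧ η < 1 := by
    have h1 : Tendsto (fun η : ℝ => η ^ 2 * S) (nhdsWithin 1 (Set.Iio 1)) (nhds S) := by
      have : Tendsto (fun η : ℝ => η ^ 2 * S) (nhds 1) (nhds (1 ^ 2 * S)) :=
        ((continuous_pow 2).mul continuous_const).tendsto 1
      rw [one_pow, one_mul] at this
      exact this.mono_left nhdsWithin_le_nhds
    exact ((h1.eventually_const_lt hL).and (Ioo_mem_nhdsLT zero_lt_one)).exists
  obtain ⟨t₁, ht₁⟩ := eventually_atTop.1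
    ((hR.eventually_const_lt (show η * a < a by nlinarith)).and (eventually_ge_atTop t₀))
  have ht₁₀ : t₀ ≤ t₁ := (ht₁ t₁ le_rfl).2
  let m : ℕ → ℕ := fun n => ⌊x * n⌋₊
  have hm : Tendsto (fun n => (m n : ℝ) / n) atTop (nhds x) := tendsto_floor_mul_div x hx0.le
  have hinv1 : Tendsto (fun n : ℕ => (1 : ℝ) / (n : ℝ)) atTop (nhds 0) :=
    tendsto_one_div_atTop_nhds_zero_nat
  have hW : Tendsto (fun n : ℕ => 2 * η ^ 2 * (a ^ 2 * (((m n : ℝ) / n) ^ 3 / 3) +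
      (1 - (m n : ℝ) / n - 1 / n) ^ 3 / 3 - t₁ * (1 / n))) atTop (nhds (η ^ 2 * S)) := by
    have := (((((hm.pow 3).div_const 3).const_mul (a ^ 2)).add
      ((((hm.const_sub 1).sub hinv1).pow 3).div_const 3)).sub
      (hinv1.const_mul (t₁ : ℝ))).const_mul (2 * η ^ 2)
    convert this using 2
    rw [hS]
    ring
  filter_upwards [hW.eventually_const_lt hη, eventually_ge_atTop t₁, eventually_gt_atTop 0]
    with n hn hnt hn0
  refine hn.trans_le ?_
  have hn0' : (0 : ℝ) < n := by exact_mod_cast hn0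
  have hfloor : (m n : ℝ) ≤ x * n := Nat.floor_le (by positivity)
  have hfloor' : x * n < m n + 1 := Nat.lt_floor_add_one _
  have hmn : m n < n := by
    have : (m n : ℝ) < n := by nlinarith
    exact_mod_cast this
  have hsum := sum_min_sq_lower ha hmn
    (by calc (1 + a) * (m n : ℝ) ≤ (1 + a) * (x * n) := by gcongr
          _ = n := by rw [← mul_assoc, hxa, one_mul])
    (by calc (n : ℝ) = (1 + a) * (x * n) := by rw [← mul_assoc, hxa, one_mul]
          _ ≤ (1 + a) * (m n + 1) := by gcongr)
  have hinit : ∑ t ∈ Finset.range t₁, (min ((n : ℝ) - t) (a * t)) ^ 2 ≤ t₁ * (n : ℝ) ^ 2 := by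
    refine (Finset.sum_le_card_nsmul _ _ ((n : ℝ) ^ 2) fun t ht => ?_).trans_eq (by simp)
    have : (t : ℝ) ≤ n := by exact_mod_cast (Finset.mem_range.1 ht).le.trans hnt
    have h0 : 0 ≤ min ((n : ℝ) - t) (a * t) := le_min (by linarith) (by positivity)
    refine pow_le_pow_left₀ h0 ((min_le_left _ _).trans ?_) 2
    simp
  have htail : η ^ 2 * ∑ t ∈ Finset.Ico t₁ (n + 1), (min ((n : ℝ) - t) (a * t)) ^ 2 ≤
      ∑ t ∈ Finset.Icc t₀ n, ((min (n - t) (R t) : ℕ) : ℝ) ^ 2 := by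
    rw [Finset.mul_sum]
    refine (Finset.sum_le_sum fun t ht => ?_).trans (Finset.sum_le_sum_of_subset_of_nonneg
      (t := Finset.Icc t₀ n) (fun t ht => ?_) fun t _ _ => by positivity)
    · rw [Finset.mem_Ico] at ht
      have htn : (t : ℝ) ≤ n := by exact_mod_cast Nat.lt_succ_iff.1 ht.2
      have ht0 : (0 : ℝ) < t := by exact_mod_cast (by omega : 0 < t)
      have h0 : 0 ≤ min ((n : ℝ) - t) (a * t) := le_min (by linarith) (by positivity)
      rw [← mul_pow]
      refine pow_le_pow_left₀ (by positivity) ?_ 2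
      rw [Nat.cast_min, Nat.cast_sub (by omega)]
      refine le_min ?_ ?_
      · have := min_le_left ((n : ℝ) - t) (a * t)
        nlinarith
      · have h1 := (ht₁ t ht.1).1
        rw [lt_div_iff₀ ht0] at h1
        have := min_le_right ((n : ℝ) - t) (a * t)
        nlinarith
    · rw [Finset.mem_Ico] at ht
      rw [Finset.mem_Icc]
      omega
  have hcard : 2 * ∑ t ∈ Finset.Icc t₀ n, ((min (n - t) (R t) : ℕ) : ℝ) ^ 2 ≤
      ((burnSet f V n).card : ℝ) := by
    rw [Finset.mul_sum]
    exact_mod_cast card_burnSet_lower hf hV ht₀ hVv hdisj n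
  have hsplit := Finset.sum_range_add_sum_Ico (fun t : ℕ => (min ((n : ℝ) - t) (a * t)) ^ 2)
    (show t₁ ≤ n + 1 by omega)
  rw [le_div_iff₀ (by positivity)]
  calc _ = 2 * η ^ 2 * (a ^ 2 * ((m n : ℝ) ^ 3 / 3) + (n - m n - 1 : ℝ) ^ 3 / 3 -
        t₁ * (n : ℝ) ^ 2) := by field_simp
    _ ≤ 2 * (η ^ 2 * ∑ t ∈ Finset.Ico t₁ (n + 1), (min ((n : ℝ) - t) (a * t)) ^ 2) := by
      rw [mul_assoc]
      gcongr
      linarith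
    _ ≤ _ := by linarith

/-- The index of the block `[6 k ^ 4, 6 (k + 1) ^ 4)` containing the time `t`. -/
def block (t : ℕ) : ℕ := Nat.sqrt (Nat.sqrt (t / 6))

lemma le_block_iff {k t : ℕ} : k ≤ block t ↔ 6 * k ^ 4 ≤ t := by
  rw [block, Nat.le_sqrt, Nat.le_sqrt, Nat.le_div_iff_mul_le (by norm_num)]
  constructor <;> intro h <;> linarith

lemma block_le (t : ℕ) : 6 * block t ^ 4 ≤ t := le_block_iff.1 le_rfl

lemma lt_block_succ (t : ℕ) : t < 6 * (block t + 1) ^ 4 := by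
  by_contra! h
  have := le_block_iff.2 h
  omega

lemma block_mono : Monotone block := fun s _ h => le_block_iff.2 ((block_le s).trans h)

lemma tendsto_block : Tendsto block atTop atTop :=
  tendsto_atTop_atTop.2 fun k => ⟨6 * k ^ 4, fun _ h => le_block_iff.2 h⟩

lemma exists_block_injection : ∃ e : ℕ → ℤ × ℤ,
    (∀ t, 1 ≤ block t →
      e t ∈ l1Ball 0 (block t ^ 2 + 6 * block t) \ l1Ball 0 (block t ^ 2)) ∧
    ∀ s t, 1 ≤ block t → block s = block t → e s = e t → s = t := by
  have hk : ∀ k : ℕ, ∃ e : ℕ → ℤ × ℤ, 1 ≤ k →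
      Set.MapsTo e (Finset.Ico (6 * k ^ 4) (6 * (k + 1) ^ 4) : Finset ℕ)
        (l1Ball 0 (k ^ 2 + 6 * k) \ l1Ball 0 (k ^ 2) : Finset (ℤ × ℤ)) ∧
      Set.InjOn e (Finset.Ico (6 * k ^ 4) (6 * (k + 1) ^ 4) : Finset ℕ) := by
    intro k
    by_cases h1 : 1 ≤ k
    · have hsub : l1Ball 0 (k ^ 2) ⊆ l1Ball 0 (k ^ 2 + 6 * k) := fun p hp => by
        rw [mem_l1Ball] at hp ⊢
        push_cast at hp ⊢
        linarith
      have hcard : (Finset.Ico (6 * k ^ 4) (6 * (k + 1) ^ 4)).card ≤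
          (l1Ball 0 (k ^ 2 + 6 * k) \ l1Ball 0 (k ^ 2)).card := by
        rw [Finset.card_sdiff_of_subset hsub, card_l1Ball, card_l1Ball, Nat.card_Ico]
        refine Nat.sub_le_iff_le_add.2 ?_
        rw [← Nat.sub_add_comm (by gcongr <;> omega)]
        refine Nat.le_sub_of_add_le ?_
        nlinarith [Nat.zero_le (k ^ 3)]
      have hencard : ((Finset.Ico (6 * k ^ 4) (6 * (k + 1) ^ 4) : Finset ℕ) : Set ℕ).encard ≤
          ((l1Ball 0 (k ^ 2 + 6 * k) \ l1Ball 0 (k ^ 2) : Finset (ℤ × ℤ)) :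
            Set (ℤ × ℤ)).encard := by
        rw [Set.encard_coe_eq_coe_finsetCard, Set.encard_coe_eq_coe_finsetCard]
        exact_mod_cast hcard
      obtain ⟨e, he, hinj⟩ := Set.Finite.exists_injOn_of_encard_le
        (Finset.finite_toSet _) hencard
      exact ⟨e, fun _ => ⟨he, hinj⟩⟩
    · exact ⟨0, fun h => absurd h h1⟩
  choose e he using hk
  have hmem : ∀ t, t ∈ Finset.Ico (6 * block t ^ 4) (6 * (block t + 1) ^ 4) := fun t =>
    Finset.mem_Ico.2 ⟨block_le t, lt_block_succ t⟩
  refine ⟨fun t => e (block t) t, fun t ht => (he _ ht).1 (hmem t), fun s t ht hst h => ?_⟩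
  have hs := hmem s
  rw [hst] at hs
  simp only [hst] at h
  exact (he _ ht).2 hs (hmem t) h

/-- Balls that tile each of a sequence of disjoint concentric square annuli. -/
lemma exists_packing {r : ℕ → ℕ} {K : ℕ} (hK : 1 ≤ K) (hr1 : ∀ k ≥ K, 1 ≤ r k)
    (hr : ∀ k ≥ K, r k * (k ^ 2 + 6 * k + 1) ≤ r (k + 1) * (k + 1) ^ 2) :
    ∃ v : ℕ → ℤ × ℤ,
      (∀ t, K ≤ block t → |(v t).1| ≤ r (block t) * (block t ^ 2 + 6 * block t) ∧
        |(v t).2| ≤ r (block t) * (block t ^ 2 + 6 * block t)) ∧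
      ∀ s t, K ≤ block s → K ≤ block t → s ≠ t →
        Disjoint (l1Ball (v s) (r (block s) - 1)) (l1Ball (v t) (r (block t) - 1)) := by
  obtain ⟨e, hmem, hinj⟩ := exists_block_injection
  have hchain : ∀ k l, K ≤ k → k + 1 ≤ l → r k * (k ^ 2 + 6 * k + 1) ≤ r l * l ^ 2 := by
    intro k l hk hl
    induction l, hl using Nat.le_induction with
    | base => exact hr k hk
    | succ l hl ih => exact ih.trans (le_trans (by gcongr; omega) (hr l (by omega)))
  let v : ℕ → ℤ × ℤ := fun t =>
    (r (block t) * ((e t).1 + (e t).2), r (block t) * ((e t).1 - (e t).2))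
  have hupper : ∀ t, K ≤ block t → |(v t).1| ≤ r (block t) * (block t ^ 2 + 6 * block t) ∧
      |(v t).2| ≤ r (block t) * (block t ^ 2 + 6 * block t) := by
    intro t ht
    have h := (Finset.mem_sdiff.1 (hmem t (by omega))).1
    simp only [mem_l1Ball, Prod.fst_zero, Prod.snd_zero, sub_zero] at h
    push_cast at h
    simp only [v, abs_mul, Nat.abs_cast]
    exact ⟨by gcongr; exact (abs_add_le _ _).trans h, by gcongr; exact (abs_sub _ _).trans h⟩
  have hlower : ∀ t, K ≤ block t → (r (block t) : ℤ) * (block t ^ 2 + 1) ≤ |(v t).1| ∨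
      (r (block t) : ℤ) * (block t ^ 2 + 1) ≤ |(v t).2| := by
    intro t ht
    have h := (Finset.mem_sdiff.1 (hmem t (by omega))).2
    simp only [mem_l1Ball, Prod.fst_zero, Prod.snd_zero, sub_zero] at h
    push_cast at h
    simp only [v, abs_mul, Nat.abs_cast]
    have : (block t : ℤ) ^ 2 + 1 ≤ |(e t).1 + (e t).2| ∨
        (block t : ℤ) ^ 2 + 1 ≤ |(e t).1 - (e t).2| := by
      simp only [Int.abs_eq_natAbs] at h ⊢
      omega
    exact this.imp (fun h => by gcongr) (fun h => by gcongr)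
  have hfar : ∀ s t, K ≤ block s → block s < block t →
      Disjoint (l1Ball (v s) (r (block s) - 1)) (l1Ball (v t) (r (block t) - 1)) := by
    intro s t hs hst
    rw [Finset.disjoint_left]
    intro p hp hp'
    rw [mem_l1Ball] at hp hp'
    have h1 := hupper s hs
    have h2 := hlower t (by omega)
    have h3 : (r (block s) : ℤ) * (block s ^ 2 + 6 * block s + 1) ≤
      r (block t) * block t ^ 2 := by exact_mod_cast hchain _ _ hs hst
    have h4 := hr1 _ hs
    have h5 := hr1 (block t) (by omega)
    rw [mul_add_one] at h2 h3
    simp only [Int.abs_eq_natAbs] at *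
    generalize (r (block s) : ℤ) * (block s ^ 2 + 6 * block s) = x at *
    generalize (r (block t) : ℤ) * block t ^ 2 = y at *
    omega
  refine ⟨v, hupper, fun s t hs ht hst => ?_⟩
  rcases lt_trichotomy (block s) (block t) with h | h | h
  · exact hfar s t hs h
  · rw [Finset.disjoint_left]
    intro p hp hp'
    rw [mem_l1Ball] at hp hp'
    have hne : e s ≠ e t := fun he => hst (hinj s t (by omega) h he)
    have h4 := hr1 _ ht
    simp only [v, h] at hp hp'
    have hdist : |(r (block t) : ℤ) * (((e s).1 - (e t).1) + ((e s).2 - (e t).2))| +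
        |(r (block t) : ℤ) * (((e s).1 - (e t).1) - ((e s).2 - (e t).2))| < 2 * r (block t) := by
      rw [show (r (block t) : ℤ) * (((e s).1 - (e t).1) + ((e s).2 - (e t).2)) =
        r (block t) * ((e s).1 + (e s).2) - r (block t) * ((e t).1 + (e t).2) by ring,
        show (r (block t) : ℤ) * (((e s).1 - (e t).1) - ((e s).2 - (e t).2)) =
        r (block t) * ((e s).1 - (e s).2) - r (block t) * ((e t).1 - (e t).2) by ring]
      simp only [Int.abs_eq_natAbs] at *
      omega
    rw [abs_mul, abs_mul, Nat.abs_cast, ← mul_add, mul_comm (2 : ℤ)] at hdist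
    have hlt := lt_of_mul_lt_mul_left hdist (by positivity)
    refine hne (Prod.ext ?_ ?_) <;> simp only [Int.abs_eq_natAbs] at hlt <;> omega
  · exact (hfar t s ht h).symm

lemma exists_monotone_minorant {u : ℕ → ℝ} {U C : ℝ} (hu : Tendsto u atTop (nhds C)) (hU : U ≤ C)
    (hU0 : 0 ≤ U) (hu0 : ∀ n, 0 ≤ u n) :
    ∃ μ : ℕ → ℝ, Monotone μ ∧ Tendsto μ atTop (nhds U) ∧ (∀ n, μ n ≤ u n) ∧ ∀ n, μ n ≤ U := by
  have hbdd : ∀ n, BddBelow (Set.range fun i => min U (u (n + i))) := fun n =>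
    ⟨0, by rintro _ ⟨i, rfl⟩; exact le_min hU0 (hu0 _)⟩
  have hle : ∀ n, ⨅ i, min U (u (n + i)) ≤ min U (u n) := fun n => ciInf_le (hbdd n) 0
  refine ⟨fun n => ⨅ i, min U (u (n + i)), ?_, ?_, fun n => (hle n).trans (min_le_right _ _),
    fun n => (hle n).trans (min_le_left _ _)⟩
  · refine monotone_nat_of_le_succ fun n => le_ciInf fun i => ?_
    have := ciInf_le (hbdd n) (i + 1)
    rwa [show n + (i + 1) = n + 1 + i by ring] at this
  · refine tendsto_order.2 ⟨fun b hb => ?_, fun b hb => Eventually.of_forall fun n =>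
      ((hle n).trans (min_le_left _ _)).trans_lt hb⟩
    obtain ⟨b', hb, hb'⟩ := exists_between hb
    obtain ⟨N, hN⟩ := eventually_atTop.1 (hu.eventually_const_lt (hb'.trans_le hU))
    filter_upwards [eventually_ge_atTop N] with n hn
    exact hb.trans_le (le_ciInf fun i => le_min hb'.le (hN _ (by omega)).le)

lemma tendsto_succ_div : Tendsto (fun k : ℕ => ((k : ℝ) + 1) / k) atTop (nhds 1) := by
  have := (tendsto_one_div_atTop_nhds_zero_nat (𝕜 := ℝ)).const_add 1
  rw [add_zero] at this
  refine this.congr' ?_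
  filter_upwards [eventually_gt_atTop 0] with k hk
  have : (k : ℝ) ≠ 0 := by positivity
  field_simp

/-- A sequence that is constant on blocks inherits its growth rate from the block sequence. -/
lemma tendsto_block_div_rpow {h : ℕ → ℝ} (h0 : ∀ k, 0 ≤ h k) {s L : ℝ} (hs : 0 < s)
    (hh : Tendsto (fun k : ℕ => h k / (6 * (k : ℝ) ^ 4) ^ s) atTop (nhds L)) :
    Tendsto (fun t : ℕ => h (block t) / (t : ℝ) ^ s) atTop (nhds L) := by
  have hratio : Tendsto (fun k : ℕ => (((((k : ℝ) + 1) / k) ^ 4) ^ s)⁻¹) atTop (nhds 1) := by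
    have := (((tendsto_succ_div.pow 4).rpow_const (p := s) (Or.inl (by norm_num))).inv₀
      (by norm_num))
    simpa using this
  have hlow : Tendsto (fun k : ℕ => h k / (6 * ((k : ℝ) + 1) ^ 4) ^ s) atTop (nhds L) := by
    have := hh.mul hratio
    rw [mul_one] at this
    refine this.congr' ?_
    filter_upwards [eventually_gt_atTop 0] with k hk
    have hk' : (0 : ℝ) < k := by exact_mod_cast hk
    rw [show 6 * ((k : ℝ) + 1) ^ 4 = (6 * (k : ℝ) ^ 4) * (((k : ℝ) + 1) / k) ^ 4 by field_simp,
      Real.mul_rpow (x := 6 * (k : ℝ) ^ 4) (by positivity) (by positivity), div_mul_eq_div_div]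
    exact (div_eq_mul_inv _ _).symm
  refine tendsto_of_tendsto_of_tendsto_of_le_of_le' (hlow.comp tendsto_block)
    (hh.comp tendsto_block) ?_ ?_
  · filter_upwards [eventually_gt_atTop 0] with t ht
    have ht' : (0 : ℝ) < t := by exact_mod_cast ht
    have : (t : ℝ) ≤ 6 * ((block t : ℝ) + 1) ^ 4 := by exact_mod_cast (lt_block_succ t).le
    have := h0 (block t)
    simp only [Function.comp]
    gcongr
  · filter_upwards [tendsto_block.eventually_gt_atTop 0] with t ht
    have ht' : (0 : ℝ) < block t := by exact_mod_cast ht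
    have : 6 * (block t : ℝ) ^ 4 ≤ (t : ℝ) := by exact_mod_cast block_le t
    have := h0 (block t)
    simp only [Function.comp]
    gcongr

lemma six_mul_pow_rpow (k : ℕ) : (6 * (k : ℝ) ^ 4) ^ ((3 : ℝ) / 2) = 6 * √6 * (k : ℝ) ^ 6 := by
  rw [Real.mul_rpow (by norm_num) (by positivity), ← Real.rpow_natCast,
    ← Real.rpow_mul (by positivity), show (3 : ℝ) / 2 = 1 + 1 / 2 by norm_num,
    Real.rpow_add (by norm_num), Real.rpow_one, ← Real.sqrt_eq_rpow]
  norm_num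

lemma tendsto_six_div : Tendsto (fun k : ℕ => 1 + 6 / (k : ℝ)) atTop (nhds 1) := by
  simpa using (tendsto_const_div_atTop_nhds_zero_nat (6 : ℝ)).const_add 1

lemma exists_asymptotic_packing {f : ℕ → ℕ} (hf : StrictMono f) {c γ : ℝ} (hγ : 0 < γ)
    (hγc : γ ≤ c)
    (hlim : Tendsto (fun n => (f n : ℝ) / (n : ℝ) ^ ((3 : ℝ) / 2)) atTop (nhds c)) :
    ∃ (v : ℕ → ℤ × ℤ) (R g : ℕ → ℕ) (t₀ : ℕ), 1 ≤ t₀ ∧ Monotone g ∧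
      Tendsto (fun n => (g n : ℝ) / (n : ℝ) ^ ((3 : ℝ) / 2)) atTop (nhds γ) ∧
      Tendsto (fun t => (R t : ℝ) / t) atTop (nhds (√6 * γ)) ∧
      (∀ t ≥ t₀, inGrid f t (v t) ∧ inGrid g t (v t)) ∧
      ∀ s ≥ t₀, ∀ t ≥ t₀, s ≠ t → Disjoint (l1Ball (v s) (R s)) (l1Ball (v t) (R t)) := by
  set U := 6 * √6 * γ with hU
  have hU0 : 0 < U := by positivity
  have hu : Tendsto (fun k : ℕ => (f (6 * k ^ 4) : ℝ) / ((k : ℝ) ^ 6 + 6 * (k : ℝ) ^ 5)) atTop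
      (nhds (6 * √6 * c)) := by
    have h6 : Tendsto (fun k : ℕ => 6 * k ^ 4) atTop atTop :=
      (tendsto_pow_atTop (by norm_num)).const_mul_atTop' (by norm_num)
    have := ((hlim.comp h6).const_mul (6 * √6)).div tendsto_six_div one_ne_zero
    rw [div_one] at this
    refine this.congr' ?_
    filter_upwards [eventually_gt_atTop 0] with k hk
    have hk' : (0 : ℝ) < k := by exact_mod_cast hk
    simp only [Function.comp, Pi.div_apply]
    push_cast
    rw [six_mul_pow_rpow]
    field_simp
  obtain ⟨μ, hμmono, hμlim, hμu, hμU⟩ := exists_monotone_minorant (U := U) hu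
    (by rw [hU]; gcongr) hU0.le (fun k => by positivity)
  let r : ℕ → ℕ := fun k => ⌊μ k * (k : ℝ) ^ 4⌋₊
  have hev : ∀ᶠ k : ℕ in atTop, 1 ≤ μ k * k := by
    filter_upwards [hμlim.eventually_const_lt (half_lt_self hU0),
      eventually_ge_atTop ⌈2 / U⌉₊] with k hk hk'
    have h1 : 2 / U ≤ k := (Nat.le_ceil _).trans (by exact_mod_cast hk')
    calc (1 : ℝ) = U / 2 * (2 / U) := by field_simp
      _ ≤ μ k * k := mul_le_mul hk.le h1 (by positivity) (by linarith)
  obtain ⟨K, hK⟩ := eventually_atTop.1 (hev.and ((hμlim.eventually_const_lt hU0).and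
    (eventually_ge_atTop 1)))
  have hK1 : 1 ≤ K := (hK K le_rfl).2.2
  have hr1 : ∀ k ≥ K, 1 ≤ r k := fun k hk => by
    obtain ⟨h1, h2, h3⟩ := hK k hk
    refine Nat.le_floor ?_
    have h3' : (1 : ℝ) ≤ k := by exact_mod_cast h3
    calc ((1 : ℕ) : ℝ) ≤ μ k * k := by simpa using h1
      _ ≤ μ k * (k : ℝ) ^ 4 := by gcongr; exact le_self_pow₀ h3' (by norm_num)
  have hrle : ∀ k ≥ K, (r k : ℝ) ≤ μ k * (k : ℝ) ^ 4 := fun k hk =>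
    Nat.floor_le (mul_nonneg (hK k hk).2.1.le (by positivity))
  have hr : ∀ k ≥ K, r k * (k ^ 2 + 6 * k + 1) ≤ r (k + 1) * (k + 1) ^ 2 := fun k hk => by
    obtain ⟨h1, h2, h3⟩ := hK k hk
    have h3' : (1 : ℝ) ≤ k := by exact_mod_cast h3
    have hlow : μ k * ((k : ℝ) + 1) ^ 4 - 1 ≤ r (k + 1) := by
      have := Nat.lt_floor_add_one (μ (k + 1) * ((k + 1 : ℕ) : ℝ) ^ 4)
      have hm : μ k * ((k : ℝ) + 1) ^ 4 ≤ μ (k + 1) * ((k : ℝ) + 1) ^ 4 := by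
        gcongr
        exact hμmono k.le_succ
      push_cast at this
      simp only [r]
      push_cast
      linarith
    have : (r k : ℝ) * ((k : ℝ) ^ 2 + 6 * k + 1) ≤ r (k + 1) * ((k : ℝ) + 1) ^ 2 := by
      calc (r k : ℝ) * ((k : ℝ) ^ 2 + 6 * k + 1)
          ≤ μ k * (k : ℝ) ^ 4 * ((k : ℝ) ^ 2 + 6 * k + 1) := by gcongr; exact hrle k hk
        _ ≤ (μ k * ((k : ℝ) + 1) ^ 4 - 1) * ((k : ℝ) + 1) ^ 2 := by
          have h4 : 0 ≤ (μ k * k - 1) * ((k : ℝ) + 1) ^ 2 :=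
            mul_nonneg (by linarith) (by positivity)
          have h5 : 0 ≤ μ k * (k : ℝ) ^ 3 * (k - 1) :=
            mul_nonneg (by positivity) (by linarith)
          have h6 : 0 ≤ μ k * (14 * (k : ℝ) ^ 4 + 19 * (k : ℝ) ^ 3 + 13 * (k : ℝ) ^ 2 +
            5 * k + 1) := by positivity
          nlinarith
        _ ≤ _ := by gcongr
    exact_mod_cast this
  obtain ⟨v, hv, hdisj⟩ := exists_packing hK1 hr1 hr
  have hblock : ∀ t ≥ 6 * K ^ 4, K ≤ block t := fun t ht => le_block_iff.2 ht
  have hbound : ∀ k ≥ K, (r k : ℝ) * ((k : ℝ) ^ 2 + 6 * k) ≤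
      μ k * ((k : ℝ) ^ 6 + 6 * (k : ℝ) ^ 5) :=
    fun k hk => by
      calc _ ≤ μ k * (k : ℝ) ^ 4 * ((k : ℝ) ^ 2 + 6 * k) := by gcongr; exact hrle k hk
        _ = _ := by ring
  have hboundf : ∀ t, K ≤ block t → r (block t) * (block t ^ 2 + 6 * block t) ≤ f t := by
    intro t ht
    have hpos : (0 : ℝ) < block t := by exact_mod_cast (by omega : 0 < block t)
    refine le_trans ?_ (hf.monotone (block_le t))
    have h := hμu (block t)
    rw [le_div_iff₀ (by positivity)] at h
    exact_mod_cast (hbound _ ht).trans h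
  let G : ℕ → ℕ := fun k => ⌊U * ((k : ℝ) ^ 6 + 6 * (k : ℝ) ^ 5)⌋₊
  have hboundG : ∀ t, K ≤ block t →
      r (block t) * (block t ^ 2 + 6 * block t) ≤ G (block t) := by
    intro t ht
    refine Nat.le_floor ?_
    push_cast
    refine (hbound _ ht).trans ?_
    gcongr
    exact hμU _
  refine ⟨v, fun t => r (block t) - 1, fun t => G (block t), 6 * K ^ 4, ?_, ?_, ?_, ?_, ?_, ?_⟩
  · have := Nat.one_le_pow 4 K hK1
    omega
  · intro s t hst
    have := block_mono hst
    simp only [G]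
    gcongr
  · refine tendsto_block_div_rpow (h := fun k => (G k : ℝ)) (fun k => by positivity)
      (by norm_num) ?_
    have hfl : Tendsto (fun x : ℝ => (⌊x⌋₊ : ℝ) / x) atTop (nhds 1) :=
      tendsto_nat_floor_div_atTop
    have hX : Tendsto (fun k : ℕ => U * ((k : ℝ) ^ 6 + 6 * (k : ℝ) ^ 5)) atTop atTop := by
      refine Tendsto.const_mul_atTop hU0 (tendsto_atTop_mono
        (fun k => le_add_of_nonneg_right (by positivity)) ?_)
      exact (tendsto_pow_atTop (by norm_num)).comp tendsto_natCast_atTop_atTop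
    have := ((hfl.comp hX).mul tendsto_six_div).const_mul γ
    rw [mul_one, mul_one] at this
    refine this.congr' ?_
    filter_upwards [eventually_gt_atTop 0] with k hk
    have hk' : (0 : ℝ) < k := by exact_mod_cast hk
    simp only [Function.comp, G, six_mul_pow_rpow, hU]
    field_simp
  · have key : Tendsto (fun t : ℕ => ((r (block t) - 1 : ℕ) : ℝ) / (t : ℝ) ^ (1 : ℝ)) atTop
        (nhds (√6 * γ)) := by
      refine tendsto_block_div_rpow (h := fun k => ((r k - 1 : ℕ) : ℝ)) (fun k => by positivity)
        one_pos ?_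
      have hpow : Tendsto (fun k : ℕ => (k : ℝ) ^ 4) atTop atTop :=
        (tendsto_pow_atTop (by norm_num)).comp tendsto_natCast_atTop_atTop
      have hlow := (hμlim.sub (hpow.inv_tendsto_atTop.const_mul 2)).div_const 6
      have hup := hμlim.div_const 6
      rw [mul_zero, sub_zero] at hlow
      rw [show U / 6 = √6 * γ by rw [hU]; ring] at hlow hup
      refine tendsto_of_tendsto_of_tendsto_of_le_of_le' hlow hup ?_ ?_
      · filter_upwards [eventually_ge_atTop K] with k hk
        have hk' : (0 : ℝ) < k := by exact_mod_cast (by omega : 0 < k)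
        have := Nat.lt_floor_add_one (μ k * (k : ℝ) ^ 4)
        rw [Real.rpow_one, Nat.cast_sub (hr1 k hk), le_div_iff₀ (by positivity)]
        simp only [Pi.inv_apply, r]
        field_simp
        push_cast
        linarith
      · filter_upwards [eventually_ge_atTop K] with k hk
        have hk' : (0 : ℝ) < k := by exact_mod_cast (by omega : 0 < k)
        have := hrle k hk
        rw [Real.rpow_one, Nat.cast_sub (hr1 k hk), div_le_iff₀ (by positivity)]
        push_cast
        linarith
    simpa only [Real.rpow_one] using key
  · intro t ht
    have h := hv t (hblock t ht)
    have h1 := hboundf t (hblock t ht)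
    have h2 := hboundG t (hblock t ht)
    zify at h1 h2
    exact ⟨⟨h.1.trans h1, h.2.trans h1⟩, ⟨h.1.trans h2, h.2.trans h2⟩⟩
  · exact fun s hs t ht => hdisj s t (hblock s hs) (hblock t ht)

lemma tendsto_card_grid {f : ℕ → ℕ} {c : ℝ}
    (hlim : Tendsto (fun n => (f n : ℝ) / (n : ℝ) ^ ((3 : ℝ) / 2)) atTop (nhds c)) :
    Tendsto (fun n : ℕ => (2 * (f n : ℝ) + 1) ^ 2 / (n : ℝ) ^ 3) atTop (nhds ((2 * c) ^ 2)) := by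
  have := ((hlim.const_mul 2).add tendsto_one_div_rpow_three_halves).pow 2
  rw [add_zero] at this
  refine this.congr fun n => ?_
  rw [← rpow_three_halves_sq, ← div_pow, add_div, mul_div_assoc]

lemma tendsto_densitySeq {f : ℕ → ℕ} {c S : ℝ} (hc : 0 < c)
    (hlim : Tendsto (fun n => (f n : ℝ) / (n : ℝ) ^ ((3 : ℝ) / 2)) atTop (nhds c))
    {V : ℕ → Option (ℤ × ℤ)}
    (hS : Tendsto (fun n : ℕ => ((burnSet f V n).card : ℝ) / (n : ℝ) ^ 3) atTop (nhds S)) :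
    HasBurningDensity f V (S / (2 * c) ^ 2) := by
  refine (hS.div (tendsto_card_grid hlim) (by positivity)).congr' ?_
  filter_upwards [eventually_gt_atTop 0] with n hn
  have hn' : (0 : ℝ) < n := by exact_mod_cast hn
  simp only [Pi.div_apply, densitySeq]
  field_simp

/-- No activator sequence achieves more than the density `(1 + √6 c)⁻²`. -/
lemma burningDensity_le {f : ℕ → ℕ} (hf : StrictMono f) {c ρ : ℝ} (hc : 0 < c)
    (hlim : Tendsto (fun n => (f n : ℝ) / (n : ℝ) ^ ((3 : ℝ) / 2)) atTop (nhds c))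
    {V : ℕ → Option (ℤ × ℤ)} (hV : IsActivator f V) (hρ : HasBurningDensity f V ρ) :
    ρ ≤ ((1 + √6 * c) ^ 2)⁻¹ := by
  obtain ⟨U, hU, hle⟩ := card_burnSet_upper hf hf.monotone hV hV hc hlim
  have hB : Tendsto (fun n : ℕ => ((burnSet f V n).card : ℝ) / (n : ℝ) ^ 3) atTop
      (nhds (ρ * (2 * c) ^ 2)) := by
    refine (Tendsto.mul hρ (tendsto_card_grid hlim)).congr fun n => ?_
    have : (2 * (f n : ℝ) + 1) ≠ 0 := by positivity
    simp only [densitySeq]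
    field_simp
  have h := le_of_tendsto_of_tendsto' hB hU hle
  have hpos : 0 < (2 * c) ^ 2 := by positivity
  rw [div_pow] at h
  refine le_of_mul_le_mul_right (h.trans_eq ?_) hpos
  ring

/-- Tiling a grid of side `2 γ n ^ (3 / 2)` achieves the density `(γ / (c (1 + √6 γ)))²`. -/
lemma exists_activator_of_le {f : ℕ → ℕ} (hf : StrictMono f) {c γ : ℝ} (hγ : 0 < γ) (hγc : γ ≤ c)
    (hlim : Tendsto (fun n => (f n : ℝ) / (n : ℝ) ^ ((3 : ℝ) / 2)) atTop (nhds c)) :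
    ∃ V : ℕ → Option (ℤ × ℤ), IsActivator f V ∧ (∃ t, 1 ≤ t ∧ V t ≠ none) ∧
      HasBurningDensity f V ((2 * γ / (1 + √6 * γ)) ^ 2 / (2 * c) ^ 2) := by
  obtain ⟨v, R, g, t₀, ht₀, hg, hglim, hR, hv, hdisj⟩ :=
    exists_asymptotic_packing hf hγ hγc hlim
  let V : ℕ → Option (ℤ × ℤ) := fun t => if t₀ ≤ t then some (v t) else none
  have hVv : ∀ t ≥ t₀, V t = some (v t) := fun t ht => if_pos ht
  have hVmem : ∀ t p, V t = some p → t₀ ≤ t ∧ v t = p := by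
    intro t p h
    simpa [V] using h
  have hVf : IsActivator f V := by
    intro t _ p h
    obtain ⟨ht, rfl⟩ := hVmem t p h
    exact (hv t ht).1
  have hVg : IsActivator g V := by
    intro t _ p h
    obtain ⟨ht, rfl⟩ := hVmem t p h
    exact (hv t ht).2
  refine ⟨V, hVf, ⟨t₀, ht₀, by simp [V]⟩, tendsto_densitySeq (hγ.trans_le hγc) hlim ?_⟩
  obtain ⟨U, hU, hle⟩ := card_burnSet_upper hf hg hVf hVg hγ hglim
  refine tendsto_order.2 ⟨fun L hL => ?_, fun L hL => ?_⟩
  · refine card_burnSet_lower_of_tendsto hf hVf ht₀ hVv hdisj (by positivity) hR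
      (hL.trans_eq ?_)
    rw [← optimal_split γ hγ, mul_pow, Real.sq_sqrt (by norm_num)]
    ring
  · filter_upwards [hU.eventually_lt_const hL] with n hn
    exact (hle n).trans_lt hn

lemma exists_activator_density_zero {f : ℕ → ℕ} (hf : StrictMono f) {c : ℝ} (hc : 0 < c)
    (hlim : Tendsto (fun n => (f n : ℝ) / (n : ℝ) ^ ((3 : ℝ) / 2)) atTop (nhds c)) :
    ∃ V : ℕ → Option (ℤ × ℤ), IsActivator f V ∧ (∃ t, 1 ≤ t ∧ V t ≠ none) ∧
      HasBurningDensity f V 0 := by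
  let V : ℕ → Option (ℤ × ℤ) := fun t => if t = 1 then some 0 else none
  have hV : IsActivator f V := by
    intro t _ p h
    obtain ⟨-, rfl⟩ : t = 1 ∧ 0 = p := by simpa [V] using h
    simp [inGrid]
  refine ⟨V, hV, ⟨1, le_rfl, by simp [V]⟩, ?_⟩
  rw [show (0 : ℝ) = 0 / (2 * c) ^ 2 by simp]
  refine tendsto_densitySeq hc hlim ?_
  have hcard : ∀ n, (burnSet f V n).card ≤ (n + 1) ^ 2 + n ^ 2 := by
    intro n
    rw [← card_l1Ball 0 n]
    refine Finset.card_le_card fun p hp => ?_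
    obtain ⟨t, v, h1, h2, h3, h4⟩ := (mem_burnSet_iff hf hV n p).1 hp
    obtain ⟨rfl, rfl⟩ : t = 1 ∧ 0 = v := by simpa [V] using h3
    rw [mem_l1Ball] at h4 ⊢
    omega
  have hinv : Tendsto (fun n : ℕ => (5 : ℝ) * (1 / (n : ℝ))) atTop (nhds 0) := by
    simpa using (tendsto_one_div_atTop_nhds_zero_nat (𝕜 := ℝ)).const_mul 5
  refine squeeze_zero' (Eventually.of_forall fun n => by positivity) ?_ hinv
  filter_upwards [eventually_ge_atTop 1] with n hn
  have hn' : (1 : ℝ) ≤ n := by exact_mod_cast hn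
  have h : ((burnSet f V n).card : ℝ) ≤ ((n : ℝ) + 1) ^ 2 + (n : ℝ) ^ 2 := by
    exact_mod_cast hcard n
  rw [div_le_iff₀ (by positivity)]
  refine h.trans ?_
  field_simp
  nlinarith

/-- if `f` is strictly increasing with `f(n)/n^(3/2) → c` for some `c > 0`,
then `P(G(f)) = [0, (1 + √6 c)⁻²]`. -/
theorem burning_density_asymptotically_three_halves (c : ℝ) (hc : 0 < c) (f : ℕ → ℕ)
    (hmono : StrictMono f)
    (hlim : Tendsto (fun n => (f n : ℝ) / (n : ℝ) ^ ((3 : ℝ) / 2)) atTop (nhds c)) :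
    densSet f = Set.Icc 0 (((1 + Real.sqrt 6 * c) ^ 2)⁻¹) := by
  ext ρ
  constructor
  · rintro ⟨⟨h0, -⟩, V, hV, -, hρ⟩
    exact ⟨h0, burningDensity_le hmono hc hlim hV hρ⟩
  · rintro ⟨h0, hle⟩
    have hpos : 0 < 1 + √6 * c := by positivity
    have hρ1 : ρ ≤ 1 := hle.trans (inv_le_one_of_one_le₀ (one_le_pow₀ (by simp; positivity)))
    refine ⟨⟨h0, hρ1⟩, ?_⟩
    rcases h0.eq_or_lt with rfl | hρ
    · exact exists_activator_density_zero hmono hc hlim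
    have hs : 0 < √ρ := Real.sqrt_pos.2 hρ
    have hs1 : √ρ * (1 + √6 * c) ≤ 1 := by
      have h := Real.sqrt_le_sqrt hle
      rw [Real.sqrt_inv, Real.sqrt_sq hpos.le] at h
      calc √ρ * (1 + √6 * c) ≤ (1 + √6 * c)⁻¹ * (1 + √6 * c) := by gcongr
        _ = 1 := inv_mul_cancel₀ hpos.ne'
    set d := 1 - √6 * (√ρ * c) with hd_def
    have hd : √ρ ≤ d := by rw [hd_def]; linarith
    have hd0 : 0 < d := hs.trans_le hd
    have hγc : √ρ * c / d ≤ c := by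
      rw [div_le_iff₀ hd0]
      nlinarith
    obtain ⟨V, hV, hne, hden⟩ := exists_activator_of_le hmono (γ := √ρ * c / d)
      (by positivity) hγc hlim
    refine ⟨V, hV, hne, ?_⟩
    have h1 : 1 + √6 * (√ρ * c / d) = 1 / d := by
      field_simp
      rw [hd_def]
      ring
    rw [h1] at hden
    convert hden using 1
    field_simp
    exact (Real.sq_sqrt h0).symm
end

section
/- Let f : ℕ → ℕ have controlled growth and satisfy f(n) = ω(n) and f(n) = o(n^{3/2}). Then the set of achievable burning densities is P(G(f)) = [0, 1]. -/
open Filter Asymptotics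

/-- A vertex of the box `[-m, m]²` belongs to the finset product of integer intervals. -/
lemma mem_box_iff (m : ℕ) (p : ℤ × ℤ) :
    p ∈ Finset.Icc (-(m : ℤ)) m ×ˢ Finset.Icc (-(m : ℤ)) m ↔ |p.1| ≤ m ∧ |p.2| ≤ m := by
  simp only [Finset.mem_product, Finset.mem_Icc, abs_le]

lemma card_box (m : ℕ) :
    (Finset.Icc (-(m : ℤ)) m ×ˢ Finset.Icc (-(m : ℤ)) m).card = (2 * m + 1) ^ 2 := by
  rw [Finset.card_product, Int.card_Icc, sq]
  congr 1 <;> omega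

lemma mem_burnSet_succ {f : ℕ → ℕ} {V : ℕ → Option (ℤ × ℤ)} {n : ℕ} {p : ℤ × ℤ} :
    p ∈ burnSet f V (n + 1) ↔
      V (n + 1) = some p ∨ p ∈ burnSet f V n ∨
        inGrid f (n + 1) p ∧ ∃ q ∈ burnSet f V n, p ∈ nbrs q := by
  rw [burnSet]
  rcases h : V (n + 1) with _ | v
  · simp only [Finset.mem_union, Finset.mem_filter, Finset.mem_biUnion]
    simp [and_comm]
  · simp only [Finset.mem_insert, Finset.mem_union, Finset.mem_filter, Finset.mem_biUnion,
      Option.some.injEq]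
    rw [eq_comm (a := p), and_comm (a := inGrid f (n + 1) p)]

lemma abs_le_of_mem_nbrs {p q : ℤ × ℤ} (h : p ∈ nbrs q) :
    |p.1| ≤ |q.1| + 1 ∧ |p.2| ≤ |q.2| + 1 := by
  simp only [nbrs, Finset.mem_insert, Finset.mem_singleton] at h
  rcases h with rfl | rfl | rfl | rfl <;> dsimp only <;> grind

/-- A vertex other than `v` has a lattice neighbour that is closer to `v`. -/
lemma exists_nbr_closer {p v : ℤ × ℤ} (h : p ≠ v) :
    ∃ q, p ∈ nbrs q ∧ |q.1 - v.1| + |q.2 - v.2| + 1 = |p.1 - v.1| + |p.2 - v.2| := by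
  obtain ⟨x, y⟩ := p
  obtain ⟨a, b⟩ := v
  simp only [nbrs, Finset.mem_insert, Finset.mem_singleton, Prod.mk.injEq]
  rcases lt_trichotomy x a with hx | rfl | hx
  · exact ⟨(x + 1, y), by simp, by dsimp only; grind⟩
  · rcases lt_trichotomy y b with hy | rfl | hy
    · exact ⟨(x, y + 1), by simp, by dsimp only; grind⟩
    · exact absurd rfl h
    · exact ⟨(x, y - 1), by simp, by dsimp only; grind⟩
  · exact ⟨(x - 1, y), by simp, by dsimp only; grind⟩

/-- If the grid grows at every step from time `N` on, a vertex activated at time `s ≥ N` burns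
the whole `L¹`-ball of radius `n - s` by time `n`. -/
lemma mem_burnSet_of_dist_le {f : ℕ → ℕ} {V : ℕ → Option (ℤ × ℤ)} {N : ℕ}
    (hf : ∀ n, N ≤ n → f n < f (n + 1)) (hV : IsActivator f V) {s : ℕ} (hs : N ≤ s)
    (hs1 : 1 ≤ s) {v : ℤ × ℤ} (hv : V s = some v) (d : ℕ) (p : ℤ × ℤ)
    (hp : |p.1 - v.1| + |p.2 - v.2| ≤ d) : p ∈ burnSet f V (s + d) := by
  have hfd : ∀ d, f s + d ≤ f (s + d) := by
    intro d
    induction d with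
    | zero => rfl
    | succ d ih => have := hf (s + d) (by omega); rw [← add_assoc, ← add_assoc]; omega
  induction d generalizing p with
  | zero =>
    obtain ⟨m, rfl⟩ : ∃ m, s = m + 1 := ⟨s - 1, by omega⟩
    have : p = v := by
      have h1 := abs_nonneg (p.1 - v.1)
      have h2 := abs_nonneg (p.2 - v.2)
      push_cast at hp
      exact Prod.ext (sub_eq_zero.1 (abs_eq_zero.1 (by omega)))
        (sub_eq_zero.1 (abs_eq_zero.1 (by omega)))
    rw [add_zero, mem_burnSet_succ, this]
    exact Or.inl hv
  | succ d ih =>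
    rw [← add_assoc, mem_burnSet_succ]
    by_cases hpv : p = v
    · exact Or.inr (Or.inl (ih p (by simp [hpv])))
    · obtain ⟨q, hq, hqd⟩ := exists_nbr_closer hpv
      refine Or.inr (Or.inr ⟨?_, q, ih q (by push_cast at hp; omega), hq⟩)
      have h1 := hV s hs1 v hv
      have h2 : f s + (d + 1) ≤ f (s + d + 1) := hfd (d + 1)
      unfold inGrid at *
      zify at h2
      push_cast at hp
      have h3 := abs_sub_abs_le_abs_sub p.1 v.1
      have h4 := abs_sub_abs_le_abs_sub p.2 v.2
      have h5 := abs_nonneg (p.1 - v.1)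
      have h6 := abs_nonneg (p.2 - v.2)
      omega

/-- If all activators lie in boxes of half-width `g n`, increasing from time `N` on, and none is
used before time `N`, the burning set stays in the box of half-width `g n + n`. -/
lemma abs_le_of_mem_burnSet {f g : ℕ → ℕ} {V : ℕ → Option (ℤ × ℤ)} {N : ℕ}
    (hg : ∀ n, N ≤ n → g n ≤ g (n + 1)) (hN : ∀ n, n < N → V n = none)
    (hVg : ∀ n p, V n = some p → |p.1| ≤ g n ∧ |p.2| ≤ g n) (n : ℕ) :
    (n < N → burnSet f V n = ∅) ∧
      ∀ p ∈ burnSet f V n, |p.1| ≤ ((g n + n : ℕ) : ℤ) ∧ |p.2| ≤ ((g n + n : ℕ) : ℤ) := by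
  induction n with
  | zero => simp [burnSet]
  | succ n ih =>
    have hempty : n + 1 < N → burnSet f V (n + 1) = ∅ := by
      intro h
      ext p
      rw [mem_burnSet_succ, ih.1 (by omega), hN _ h]
      simp
    refine ⟨hempty, fun p hp => ?_⟩
    rw [mem_burnSet_succ] at hp
    rcases hp with hp | hp
    · have := hVg _ _ hp
      push_cast
      omega
    · have hn : N ≤ n := by
        by_contra! h
        rw [ih.1 h] at hp
        simp at hp
      have hgn := hg n hn
      rcases hp with hp | ⟨-, q, hq, hpq⟩
      · have := ih.2 p hp
        push_cast at *
        omega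
      · have := ih.2 q hq
        have := abs_le_of_mem_nbrs hpq
        push_cast at *
        omega

/-- An enumeration of the points of the lattice `r ℤ²` in the box of half-width `M r`. -/
def netPoint (M r i : ℕ) : ℤ × ℤ :=
  (((i / (2 * M + 1) % (2 * M + 1) : ℕ) - (M : ℤ)) * r, ((i % (2 * M + 1) : ℕ) - (M : ℤ)) * r)

lemma abs_netPoint_le (M r i : ℕ) :
    |(netPoint M r i).1| ≤ ((M * r : ℕ) : ℤ) ∧ |(netPoint M r i).2| ≤ ((M * r : ℕ) : ℤ) := by
  have key : ∀ j : ℕ, |((j % (2 * M + 1) : ℕ) - (M : ℤ)) * r| ≤ ((M * r : ℕ) : ℤ) := by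
    intro j
    have := Nat.mod_lt j (show 0 < 2 * M + 1 by omega)
    rw [abs_mul, Nat.abs_cast, Nat.cast_mul]
    refine mul_le_mul_of_nonneg_right ?_ (by positivity)
    generalize j % (2 * M + 1) = i at this ⊢
    rw [abs_le]
    constructor <;> omega
  exact ⟨key _, key _⟩

/-- Every point of the box of half-width `M r` is at `L¹`-distance at most `2 r` from one of the
`(2 M + 1)²` net points. -/
lemma exists_netPoint_near {M r : ℕ} (hr : 1 ≤ r) {p : ℤ × ℤ}
    (hp : |p.1| ≤ ((M * r : ℕ) : ℤ) ∧ |p.2| ≤ ((M * r : ℕ) : ℤ)) :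
    ∃ i < (2 * M + 1) ^ 2,
      |p.1 - (netPoint M r i).1| + |p.2 - (netPoint M r i).2| ≤ ((2 * r : ℕ) : ℤ) := by
  have hr0 : (0 : ℤ) < r := by exact_mod_cast hr
  have key : ∀ x : ℤ, |x| ≤ ((M * r : ℕ) : ℤ) →
      ∃ j : ℕ, j < 2 * M + 1 ∧ |x - ((j : ℤ) - M) * r| ≤ r := by
    intro x hx
    push_cast at hx
    rw [abs_le] at hx
    have h1 : -(M : ℤ) ≤ x / r := by
      rw [Int.le_ediv_iff_mul_le hr0]; linarith
    have h2 : x / r ≤ M := by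
      rw [← Int.lt_add_one_iff, Int.ediv_lt_iff_lt_mul hr0]; linarith
    refine ⟨(x / r + M).toNat, by omega, ?_⟩
    rw [Int.toNat_of_nonneg (by omega), add_sub_cancel_right]
    have h3 := Int.emod_add_mul_ediv x r
    have h4 := Int.emod_nonneg x hr0.ne'
    have h5 := Int.emod_lt_of_pos x hr0
    rw [show x - x / r * r = x % r by linarith, abs_of_nonneg h4]
    exact h5.le
  obtain ⟨a, ha, ha'⟩ := key _ hp.1
  obtain ⟨b, hb, hb'⟩ := key _ hp.2
  refine ⟨a * (2 * M + 1) + b, by nlinarith, ?_⟩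
  have hdiv : (a * (2 * M + 1) + b) / (2 * M + 1) = a := by
    rw [mul_comm, Nat.mul_add_div (by omega), Nat.div_eq_of_lt hb, add_zero]
  have hmod : (a * (2 * M + 1) + b) % (2 * M + 1) = b := by
    rw [Nat.mul_add_mod_self_right, Nat.mod_eq_of_lt hb]
  simp only [netPoint, hdiv, Nat.mod_eq_of_lt ha, hmod]
  push_cast
  linarith

/-- The starting times of consecutive blocks, the block started at time `t` having
length `11 r(t)`. -/
def blockStart (N : ℕ) (r : ℕ → ℕ) : ℕ → ℕ
  | 0 => N
  | k + 1 => blockStart N r k + 11 * r (blockStart N r k)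

lemma blockStart_strictMono (N : ℕ) {r : ℕ → ℕ} (hr : ∀ n, 1 ≤ r n) :
    StrictMono (blockStart N r) :=
  strictMono_nat_of_lt_succ fun k => by
    have := hr (blockStart N r k)
    rw [blockStart]
    omega

/-- Every time after the first block start lies in a block. -/
lemma exists_blockStart_le_lt {N : ℕ} {r : ℕ → ℕ} (hr : ∀ n, 1 ≤ r n) {n : ℕ} (k₀ : ℕ)
    (hn : blockStart N r k₀ ≤ n) :
    ∃ k, k₀ ≤ k ∧ blockStart N r k ≤ n ∧ n < blockStart N r (k + 1) := by
  have hmono := blockStart_strictMono N hr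
  have hex : ∃ k, n < blockStart N r k := ⟨n + 1, hmono.id_le (n + 1)⟩
  obtain ⟨k, hk⟩ : ∃ k, Nat.find hex = k + 1 := by
    refine Nat.exists_eq_add_one.2 ((Nat.find_pos hex).2 ?_)
    have := hmono.monotone (Nat.zero_le k₀)
    omega
  have h1 := Nat.find_spec hex
  have h2 := Nat.find_min hex (m := k) (by omega)
  rw [hk] at h1
  refine ⟨k, ?_, by omega, h1⟩
  by_contra! h
  have := hmono.monotone (show k + 1 ≤ k₀ by omega)
  omega

/-- Block by block activation of nets: the resulting burning set stays within distance `n` of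
the box of half-width `g n`, and at the end of each block it contains the box spanned by the net
of that block. -/
lemma exists_activator {f g M r : ℕ → ℕ} {N : ℕ} (hN : 1 ≤ N)
    (hf : ∀ n, N ≤ n → f n < f (n + 1)) (hg : ∀ n, N ≤ n → g n ≤ g (n + 1))
    (hgf : ∀ n, g n ≤ f n) (hr : ∀ n, 1 ≤ r n) (hM : ∀ n, (2 * M n + 1) ^ 2 ≤ 9 * r n)
    (hMg : ∀ n, M n * r n ≤ g n) :
    ∃ V : ℕ → Option (ℤ × ℤ), IsActivator f V ∧ (∃ t, 1 ≤ t ∧ V t ≠ none) ∧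
      (∀ n, (burnSet f V n).card ≤ (2 * (g n + n) + 1) ^ 2) ∧
      ∀ k n, blockStart N r (k + 1) ≤ n →
        (2 * (M (blockStart N r k) * r (blockStart N r k)) + 1) ^ 2 ≤ (burnSet f V n).card := by
  set T := blockStart N r
  have hmono : StrictMono T := blockStart_strictMono N hr
  have hNT : ∀ k, N ≤ T k := fun k => hmono.monotone (Nat.zero_le k)
  have hsucc : ∀ k, T (k + 1) = T k + 11 * r (T k) := fun k => rfl
  have hgmono : ∀ m n, N ≤ m → m ≤ n → g m ≤ g n := by
    intro m n hm hmn
    induction n, hmn using Nat.le_induction with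
    | base => rfl
    | succ n hmn ih => exact ih.trans (hg n (by omega))
  choose! K hK using fun n (hn : N ≤ n) =>
    (exists_blockStart_le_lt hr (n := n) 0 hn : ∃ k, 0 ≤ k ∧ T k ≤ n ∧ n < T (k + 1))
  have hKeq : ∀ k n, T k ≤ n → n < T (k + 1) → K n = k := by
    intro k n h1 h2
    obtain ⟨-, h3, h4⟩ := hK n ((hNT k).trans h1)
    have := hmono.lt_iff_lt.1 (h1.trans_lt h4)
    have := hmono.lt_iff_lt.1 (h3.trans_lt h2)
    omega
  set V : ℕ → Option (ℤ × ℤ) := fun n =>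
    if n < N then none else some (netPoint (M (T (K n))) (r (T (K n))) (n - T (K n))) with hVdef
  have hV_of_ge : ∀ n, N ≤ n →
      V n = some (netPoint (M (T (K n))) (r (T (K n))) (n - T (K n))) :=
    fun n hn => if_neg (by omega)
  have hVg : ∀ n p, V n = some p → |p.1| ≤ g n ∧ |p.2| ≤ g n := by
    intro n p hp
    rcases lt_or_ge n N with h | h
    · simp [hVdef, h] at hp
    · rw [hV_of_ge n h, Option.some.injEq] at hp
      have h1 := abs_netPoint_le (M (T (K n))) (r (T (K n))) (n - T (K n))
      rw [hp] at h1
      have h2 : M (T (K n)) * r (T (K n)) ≤ g n :=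
        (hMg _).trans (hgmono _ _ (hNT _) (hK n h).2.1)
      zify at h2
      push_cast at h1
      exact ⟨h1.1.trans h2, h1.2.trans h2⟩
  have hact : IsActivator f V := by
    intro n _ p hp
    have h1 := hVg n p hp
    have h2 : (g n : ℤ) ≤ f n := by exact_mod_cast hgf n
    exact ⟨h1.1.trans h2, h1.2.trans h2⟩
  refine ⟨V, hact, ⟨N, hN, by rw [hV_of_ge N le_rfl]; simp⟩, fun n => ?_, fun k n hkn => ?_⟩
  · rw [← card_box]
    refine Finset.card_le_card fun p hp => (mem_box_iff _ _).2 ?_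
    exact (abs_le_of_mem_burnSet hg (fun n hn => if_pos hn) hVg n).2 p hp
  · rw [← card_box]
    refine Finset.card_le_card fun p hp => ?_
    rw [mem_box_iff] at hp
    obtain ⟨i, hi, hpi⟩ := exists_netPoint_near (hr (T k)) hp
    have hi' : i < 9 * r (T k) := hi.trans_le (hM _)
    have hk := hsucc k
    have hVi : V (T k + i) = some (netPoint (M (T k)) (r (T k)) i) := by
      rw [hV_of_ge _ ((hNT k).trans (Nat.le_add_right _ _)),
        hKeq k (T k + i) (Nat.le_add_right _ _) (by omega), Nat.add_sub_cancel_left]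
    have hNk := hNT k
    have := mem_burnSet_of_dist_le hf hact (by omega) (by omega) hVi (n - (T k + i)) p
      (hpi.trans (by exact_mod_cast (by omega : 2 * r (T k) ≤ n - (T k + i))))
    rwa [Nat.add_sub_cancel' (by omega)] at this

/-- An integer upper bound for `f n ^ (2 / 3)`, used as spacing of the nets. -/
noncomputable def spacing (f : ℕ → ℕ) (n : ℕ) : ℕ := ⌈(f n : ℝ) ^ ((2 : ℝ) / 3)⌉₊ + 1

lemma sq_le_spacing_pow_three (f : ℕ → ℕ) (n : ℕ) : f n ^ 2 ≤ spacing f n ^ 3 := by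
  have h1 : (f n : ℝ) ^ ((2 : ℝ) / 3) ≤ (spacing f n : ℝ) := by
    rw [spacing]
    push_cast
    linarith [Nat.le_ceil ((f n : ℝ) ^ ((2 : ℝ) / 3))]
  have h2 : ((f n : ℝ) ^ ((2 : ℝ) / 3)) ^ 3 = (f n : ℝ) ^ 2 := by
    rw [← Real.rpow_natCast, ← Real.rpow_mul (by positivity)]
    norm_num
  have h3 := pow_le_pow_left₀ (by positivity) h1 3
  rw [h2] at h3
  exact_mod_cast h3

lemma spacing_le_of_le {f : ℕ → ℕ} {m n : ℕ} (h : f m ≤ f n) : spacing f m ≤ spacing f n := by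
  unfold spacing
  gcongr

lemma spacing_isLittleO {f : ℕ → ℕ}
    (hf : (fun n => (f n : ℝ)) =o[atTop] fun n => (n : ℝ) ^ ((3 : ℝ) / 2)) :
    (fun n => (spacing f n : ℝ)) =o[atTop] fun n => (n : ℝ) := by
  have h1 : (fun n => (f n : ℝ) ^ ((2 : ℝ) / 3)) =o[atTop] fun n : ℕ => (n : ℝ) := by
    have := hf.rpow (r := 2 / 3) (by norm_num) (Eventually.of_forall fun n => by positivity)
    refine this.congr_right fun n => ?_
    rw [← Real.rpow_mul (by positivity)]
    norm_num
  have h2 : (fun _ : ℕ => (2 : ℝ)) =o[atTop] fun n : ℕ => (n : ℝ) :=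
    isLittleO_const_left.2 (Or.inr
      (tendsto_norm_atTop_atTop.comp tendsto_natCast_atTop_atTop))
  refine IsBigO.trans_isLittleO (IsBigO.of_bound 1 (Eventually.of_forall fun n => ?_)) (h1.add h2)
  have h3 := (Nat.ceil_lt_add_one (show 0 ≤ (f n : ℝ) ^ ((2 : ℝ) / 3) by positivity)).le
  rw [Real.norm_of_nonneg (by positivity), Real.norm_of_nonneg (by positivity), spacing]
  push_cast
  linarith

/-- If `t n` precedes `n` by at most `c * spacing f n`, then `f (t n)` is asymptotic to `f n`. -/
lemma tendsto_div_of_le_add_spacing {f : ℕ → ℕ} {N c : ℕ}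
    (hf : ∀ m n, N ≤ m → m ≤ n → f m ≤ f n)
    (hgrowth : ∀ ε : ℕ → ℕ, (fun n => (ε n : ℝ)) =o[atTop] (fun n => (n : ℝ)) →
      Tendsto (fun n => (f (n + ε n) : ℝ) / (f n : ℝ)) atTop (nhds 1))
    (hspacing : (fun n => (spacing f n : ℝ)) =o[atTop] fun n => (n : ℝ))
    (hpos : ∀ᶠ n in atTop, 0 < f n)
    {t : ℕ → ℕ} (hNt : ∀ᶠ n in atTop, N ≤ t n) (htn : ∀ᶠ n in atTop, t n ≤ n)
    (hnt : ∀ᶠ n in atTop, n ≤ t n + c * spacing f n) :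
    Tendsto (fun n => (f (t n) : ℝ) / f n) atTop (nhds 1) := by
  have hcs : ∀ᶠ n : ℕ in atTop, c * spacing f n ≤ n / 2 := by
    have h := (hspacing.const_mul_left (c : ℝ)).bound (show (0 : ℝ) < 1 / 2 by norm_num)
    filter_upwards [h] with n hn
    rw [Real.norm_of_nonneg (by positivity), Real.norm_of_nonneg (by positivity)] at hn
    rw [Nat.le_div_iff_mul_le (by norm_num)]
    have : (c : ℝ) * spacing f n * 2 ≤ n := by linarith
    exact_mod_cast this
  have hn2 : ∀ᶠ n in atTop, n ≤ 2 * t n := by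
    filter_upwards [hcs, hnt] with n h1 h2
    omega
  have ht : Tendsto t atTop atTop := by
    refine tendsto_atTop.2 fun b => ?_
    filter_upwards [hn2, eventually_ge_atTop (2 * b)] with n h1 h2
    omega
  have hε : (fun n : ℕ => ((c * spacing f (2 * n) : ℕ) : ℝ)) =o[atTop] fun n => (n : ℝ) := by
    have h2 : Tendsto (fun n : ℕ => 2 * n) atTop atTop :=
      tendsto_atTop_mono (fun n => Nat.le_mul_of_pos_left n two_pos) tendsto_id
    have h := (hspacing.comp_tendsto h2).const_mul_left (c : ℝ)
    have h3 : ((fun n : ℕ => (n : ℝ)) ∘ fun n : ℕ => 2 * n) = fun n : ℕ => 2 * (n : ℝ) := by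
      ext n; simp
    rw [h3] at h
    refine (h.trans_isBigO ?_).congr_left fun n => by simp
    exact (isBigO_refl _ _).const_mul_left 2
  have hlim := ((hgrowth _ hε).inv₀ one_ne_zero).comp ht
  rw [inv_one] at hlim
  refine tendsto_of_tendsto_of_tendsto_of_le_of_le' hlim tendsto_const_nhds ?_ ?_
  · filter_upwards [hNt, htn, hnt, hn2, hpos, eventually_ge_atTop N] with n h1 h2 h3 h4 h5 h6
    rw [Function.comp_apply, inv_div]
    have h7 : f n ≤ f (t n + c * spacing f (2 * t n)) := by
      refine hf _ _ h6 (h3.trans ?_)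
      gcongr
      exact spacing_le_of_le (hf _ _ h6 h4)
    gcongr
  · filter_upwards [hNt, htn] with n h1 h2
    refine div_le_one_of_le₀ ?_ (by positivity)
    exact_mod_cast hf _ _ h1 h2

/-- if `f` has controlled growth, `f(n) = ω(n)` and `f(n) = o(n^(3/2))`,
then `P(G(f)) = [0, 1]`. -/
theorem burning_density_controlled_growth (f : ℕ → ℕ) (hcg : ControlledGrowth f)
    (homega : (fun n : ℕ => (n : ℝ)) =o[atTop] fun n => (f n : ℝ))
    (hlittleo : (fun n => (f n : ℝ)) =o[atTop] fun n => (n : ℝ) ^ ((3 : ℝ) / 2)) :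
    densSet f = Set.Icc 0 1 := by
  refine Set.Subset.antisymm (fun ρ hρ => hρ.1) fun ρ hρ => ⟨hρ, ?_⟩
  obtain ⟨N, hN1, hf⟩ : ∃ N, 1 ≤ N ∧ ∀ n, N ≤ n → f n < f (n + 1) := by
    obtain ⟨N, hN⟩ := eventually_atTop.1 hcg.1
    exact ⟨N + 1, by omega, fun n hn => hN n (by omega)⟩
  have hfmono : ∀ m n, N ≤ m → m ≤ n → f m ≤ f n := by
    intro m n hm hmn
    induction n, hmn using Nat.le_induction with
    | base => rfl
    | succ n hmn ih => exact ih.trans (hf n (by omega)).le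
  have hpos : ∀ᶠ n in atTop, 0 < f n := by
    filter_upwards [eventually_ge_atTop (N + 1)] with n hn
    have h1 := hf N le_rfl
    have h2 := hfmono (N + 1) n (by omega) hn
    omega
  obtain ⟨a, ha0, ha1, rfl⟩ : ∃ a : ℝ, 0 ≤ a ∧ a ≤ 1 ∧ a ^ 2 = ρ :=
    ⟨√ρ, Real.sqrt_nonneg _, Real.sqrt_le_one.2 hρ.2, Real.sq_sqrt hρ.1⟩
  set g : ℕ → ℕ := fun n => ⌊a * f n⌋₊ with hg
  set r : ℕ → ℕ := spacing f with hrdef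
  have hr : ∀ n, 1 ≤ r n := fun n => by simp [hrdef, spacing]
  have hgle : ∀ n, (g n : ℝ) ≤ a * f n := fun n => Nat.floor_le (by positivity)
  have hgf : ∀ n, g n ≤ f n := fun n => by
    have : (g n : ℝ) ≤ f n :=
      (hgle n).trans (mul_le_of_le_one_left (by positivity) ha1)
    exact_mod_cast this
  obtain ⟨V, hV, hne, hupper, hlower⟩ := exists_activator (g := g) (r := r)
    (M := fun n => g n / r n) hN1 hf
    (fun n hn => by
      have := (hf n hn).le
      simp only [hg]
      gcongr)
    hgf hr
    (fun n => by
      have h1 : (g n / r n) ^ 2 ≤ r n := by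
        have h2 : (g n / r n * r n) ^ 2 ≤ r n ^ 3 :=
          (Nat.pow_le_pow_left ((Nat.div_mul_le_self _ _).trans (hgf n)) 2).trans
            (sq_le_spacing_pow_three f n)
        refine Nat.le_of_mul_le_mul_right (c := r n ^ 2) ?_ (pow_pos (hr n) 2)
        calc _ = (g n / r n * r n) ^ 2 := by ring
          _ ≤ r n ^ 3 := h2
          _ = _ := by ring
      have := hr n
      nlinarith)
    (fun n => Nat.div_mul_le_self _ _)
  refine ⟨V, hV, hne, ?_⟩
  have hspacing := spacing_isLittleO hlittleo
  have hrn : ∀ m n, N ≤ m → m ≤ n → r m ≤ r n := fun m n hm hmn =>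
    spacing_le_of_le (hfmono m n hm hmn)
  set T := blockStart N r with hT
  have hNT : ∀ k, N ≤ T k := fun k => (blockStart_strictMono N hr).monotone (Nat.zero_le k)
  have hex : ∀ n, T 1 ≤ n → ∃ k, T (k + 1) ≤ n ∧ n ≤ T k + 22 * r n := by
    intro n hn
    obtain ⟨k, hk, h1, h2⟩ := exists_blockStart_le_lt hr 1 hn
    obtain ⟨k, rfl⟩ : ∃ j, k = j + 1 := ⟨k - 1, by omega⟩
    refine ⟨k, h1, ?_⟩
    have h3 : T (k + 1) = T k + 11 * r (T k) := rfl
    have h4 : blockStart N r (k + 1 + 1) = T (k + 1) + 11 * r (T (k + 1)) := rfl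
    have h5 := hrn _ n (hNT k) (by rw [← hT] at h1; omega)
    have h6 := hrn _ n (hNT (k + 1)) h1
    omega
  choose! k hk using hex
  have hkn : ∀ n, T 1 ≤ n → T (k n) ≤ n := fun n hn =>
    ((blockStart_strictMono N hr).monotone (Nat.le_succ _)).trans (hk n hn).1
  have hratio : Tendsto (fun n => (f (T (k n)) : ℝ) / f n) atTop (nhds 1) :=
    tendsto_div_of_le_add_spacing hfmono hcg.2.1 hspacing hpos
      (Eventually.of_forall fun n => hNT _)
      (eventually_atTop.2 ⟨T 1, hkn⟩)
      (eventually_atTop.2 ⟨T 1, fun n hn => (hk n hn).2⟩)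
  have hnf : Tendsto (fun n : ℕ => (n : ℝ) / f n) atTop (nhds 0) := homega.tendsto_div_nhds_zero
  have hrf : Tendsto (fun n : ℕ => (r n : ℝ) / f n) atTop (nhds 0) :=
    (hspacing.trans homega).tendsto_div_nhds_zero
  have h1f : Tendsto (fun n : ℕ => (1 : ℝ) / f n) atTop (nhds 0) := by
    refine squeeze_zero' (Eventually.of_forall fun n => by positivity) ?_ hrf
    filter_upwards with n
    have : (1 : ℝ) ≤ r n := by exact_mod_cast hr n
    gcongr
  have hup : Tendsto (fun n : ℕ => ((2 * a + 2 * ((n : ℝ) / f n) + 1 / f n) / (2 + 1 / f n)) ^ 2)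
      atTop (nhds (a ^ 2)) := by
    have := ((((hnf.const_mul 2).const_add (2 * a)).add h1f).div (h1f.const_add 2)
      (by norm_num)).pow 2
    rw [show (2 * a + 2 * 0 + 0) / (2 + 0) = a by ring] at this
    exact this
  have hlow : Tendsto (fun n : ℕ =>
      (max 0 ((2 * (a * ((f (T (k n)) : ℝ) / f n)) - 2 * ((r n : ℝ) / f n) - 1 / f n)
        / (2 + 1 / f n))) ^ 2) atTop (nhds (a ^ 2)) := by
    have := (((((hratio.const_mul a).const_mul 2).sub (hrf.const_mul 2)).sub h1f).div
      (h1f.const_add 2) (by norm_num))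
    have := (tendsto_const_nhds (x := (0 : ℝ)).max this).pow 2
    rw [show (2 * (a * 1) - 2 * 0 - 0) / (2 + 0) = a by ring, max_eq_right ha0] at this
    exact this
  refine tendsto_of_tendsto_of_tendsto_of_le_of_le' hlow hup ?_ ?_
  · filter_upwards [hpos, eventually_ge_atTop (T 1)] with n hfn hn
    have hfn' : (0 : ℝ) < f n := by exact_mod_cast hfn
    set s := T (k n) with hs
    have hcard : ((2 * ((g s / r s * r s : ℕ) : ℝ) + 1) ^ 2 : ℝ) ≤ (burnSet f V n).card := by
      exact_mod_cast hlower (k n) n (hk n hn).1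
    have hdm : (g s : ℝ) ≤ (g s / r s * r s : ℕ) + r n := by
      have h1 := Nat.div_add_mod (g s) (r s)
      have h2 := Nat.mod_lt (g s) (hr s)
      have h3 := hrn s n (hNT _) (hkn n hn)
      rw [mul_comm] at h1
      exact_mod_cast (by omega : g s ≤ g s / r s * r s + r n)
    have hgs : a * f s < g s + 1 := Nat.lt_floor_add_one _
    rw [densitySeq]
    calc _ ≤ ((2 * ((g s / r s * r s : ℕ) : ℝ) + 1) / (2 * f n + 1)) ^ 2 := by
          gcongr
          refine max_le (by positivity) ?_
          rw [show (2 * (a * ((f s : ℝ) / f n)) - 2 * ((r n : ℝ) / f n) - 1 / f n) / (2 + 1 / f n)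
            = (2 * (a * f s) - 2 * r n - 1) / (2 * f n + 1) by field_simp]
          gcongr
          linarith
      _ ≤ _ := by
          rw [div_pow]
          gcongr
  · filter_upwards [hpos] with n hfn
    have hfn' : (0 : ℝ) < f n := by exact_mod_cast hfn
    have hcard : ((burnSet f V n).card : ℝ) ≤ (2 * ((g n : ℝ) + n) + 1) ^ 2 := by
      exact_mod_cast hupper n
    rw [densitySeq]
    calc _ ≤ ((2 * ((g n : ℝ) + n) + 1) / (2 * f n + 1)) ^ 2 := by
          rw [div_pow]
          gcongr
      _ ≤ ((2 * (a * f n + n) + 1) / (2 * f n + 1)) ^ 2 := by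
          gcongr
          exact hgle n
      _ = _ := by
          congr 1
          field_simp
end
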